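/- arXiv:1503.04161 — 3 statements merged into one kernel-verified Lean document; each statement's English description precedes it below -/
import Mathlib

section
/- Under Assumptions 1, 2, 3 and 5 (with kernel h(x,y,t) = 1{g(x,y) ≤ t}), writing t_0 = U⁻¹(p) and t_n = U_n⁻¹(p), the quantity Σ_{r=−(n−1)}^{n−1} W(|r|/b_n) · (1/n) Σ_{i=1}^{n−|r|} ( ĥ₁(X_i,t_n) ĥ₁(X_{i+|r|},t_n) − ĥ₁(X_i,t_0) ĥ₁(X_{i+|r|},t_0) ) converges to 0 in probability as n → ∞. -/
open MeasureTheory Filter Set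
open scoped ENNReal NNReal Topology BigOperators

noncomputable section

namespace UQuantile

variable {Ω : Type*} [MeasurableSpace Ω]

/-- Strict stationarity of the pair process `((X_i, Z_i))_{i ∈ ℤ}`. -/
def IsPairStationary (P : Measure Ω) (X Z : ℤ → Ω → ℝ) : Prop :=
  ∀ (k : ℤ) (n : ℕ) (idx : Fin n → ℤ),
    P.map (fun ω i => (X (idx i) ω, Z (idx i) ω)) =
      P.map (fun ω i => (X (idx i + k) ω, Z (idx i + k) ω))

/-- Near epoch dependence in probability (PNED) of `X` on `Z` with approximation
constants `a` and gauge function `φ`. -/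
def PNED (P : Measure Ω) (X Z : ℤ → Ω → ℝ) (a : ℕ → ℝ) (φ : ℝ → ℝ) : Prop :=
  ∃ f : (l : ℕ) → ((Fin (2 * l + 1) → ℝ) → ℝ),
    (∀ l, Measurable (f l)) ∧
      ∀ (l : ℕ), ∀ ε > (0 : ℝ),
        (P {ω | ε < |X 0 ω - f l fun i => Z (((i : ℕ) : ℤ) - (l : ℤ)) ω|}).toReal ≤ a l * φ ε

/-- The σ-field generated by `..., Z_{-1}, Z_0`. -/
def pastSigma (Z : ℤ → Ω → ℝ) : MeasurableSpace Ω :=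
  ⨆ i : {i : ℤ // i ≤ 0}, MeasurableSpace.comap (Z i) Real.measurableSpace

/-- The σ-field generated by `Z_k, Z_{k+1}, ...`. -/
def futureSigma (Z : ℤ → Ω → ℝ) (k : ℕ) : MeasurableSpace Ω :=
  ⨆ i : {i : ℤ // (k : ℤ) ≤ i}, MeasurableSpace.comap (Z i) Real.measurableSpace

/-- The σ-field generated by `Z_{-l}, ..., Z_l`. -/
def rangeSigma (Z : ℤ → Ω → ℝ) (l : ℕ) : MeasurableSpace Ω :=
  ⨆ i : {i : ℤ // -(l : ℤ) ≤ i ∧ i ≤ l}, MeasurableSpace.comap (Z i) Real.measurableSpace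

/-- `β` bounds the absolute regularity coefficients of `Z`: for every `k` and every pair of
finite measurable partitions of `Ω` into past, resp. future measurable sets,
`(1/2) Σ_{i,j} |P(A_i ∩ B_j) - P(A_i) P(B_j)| ≤ β k`. -/
def IsBetaBound (P : Measure Ω) (Z : ℤ → Ω → ℝ) (β : ℕ → ℝ) : Prop :=
  ∀ (k m m' : ℕ) (A : Fin m → Set Ω) (B : Fin m' → Set Ω),
    (∀ i, MeasurableSet[pastSigma Z] (A i)) →
    (∀ j, MeasurableSet[futureSigma Z k] (B j)) →
    Pairwise (Function.onFun Disjoint A) → Pairwise (Function.onFun Disjoint B) →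
    (⋃ i, A i) = univ → (⋃ j, B j) = univ →
    (1 / 2 : ℝ) * ∑ i, ∑ j,
        |(P (A i ∩ B j)).toReal - (P (A i)).toReal * (P (B j)).toReal| ≤ β k

/-- Assumption 1: `((X_i, Z_i))` is strictly stationary, `X` is PNED on `Z` with
`a_l φ(l^{-6}) = O(l^{-6})`, and `Z` is absolutely regular with `Σ k β_k < ∞`. -/
structure Assumption1 (P : Measure Ω) (X Z : ℤ → Ω → ℝ) : Prop where
  stationary : IsPairStationary P X Z
  pned : ∃ (a : ℕ → ℝ) (φ : ℝ → ℝ),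
    Tendsto a atTop (𝓝 0) ∧ AntitoneOn φ (Ioi 0) ∧ (∀ x > (0 : ℝ), 0 < φ x) ∧
      PNED P X Z a φ ∧
      (fun l : ℕ => a l * φ ((l : ℝ) ^ (-6 : ℤ))) =O[atTop] fun l : ℕ => (l : ℝ) ^ (-6 : ℤ)
  mixing : ∃ β : ℕ → ℝ, (∀ k, 0 ≤ β k) ∧ IsBetaBound P Z β ∧
      Summable fun k : ℕ => (k : ℝ) * β k

/-- A U-quantile kernel function: nonnegative, bounded, measurable, symmetric in the first
two arguments and non-decreasing in the third. -/
structure IsUQKernel (h : ℝ → ℝ → ℝ → ℝ) : Prop where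
  nonneg : ∀ x y t, 0 ≤ h x y t
  bounded : ∃ M, ∀ x y t, h x y t ≤ M
  measurable : Measurable fun q : ℝ × ℝ × ℝ => h q.1 q.2.1 q.2.2
  symm : ∀ x y t, h x y t = h y x t
  mono : ∀ x y, Monotone (h x y)

/-- The empirical U-distribution function `U_n(t)`. -/
def Ustat (X : ℤ → Ω → ℝ) (h : ℝ → ℝ → ℝ → ℝ) (n : ℕ) (t : ℝ) (ω : Ω) : ℝ :=
  (2 / ((n : ℝ) * ((n : ℝ) - 1))) *
    ∑ i ∈ Finset.Icc (1 : ℤ) (n : ℤ), ∑ j ∈ Finset.Ioc i (n : ℤ), h (X i ω) (X j ω) t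

/-- The population U-distribution function `U(t) = E h(X, Y, t)` for `X, Y` independent
with law `μ`. -/
def Udist (μ : Measure ℝ) (h : ℝ → ℝ → ℝ → ℝ) (t : ℝ) : ℝ := ∫ x, ∫ y, h x y t ∂μ ∂μ

/-- The linear part of the Hoeffding decomposition, `h₁(x, t) = E h(x, X₀, t) - U(t)`. -/
def h1 (μ : Measure ℝ) (h : ℝ → ℝ → ℝ → ℝ) (x t : ℝ) : ℝ := (∫ y, h x y t ∂μ) - Udist μ h t

/-- The degenerate part of the Hoeffding decomposition. -/
def h2 (μ : Measure ℝ) (h : ℝ → ℝ → ℝ → ℝ) (x y t : ℝ) : ℝ :=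
  h x y t - h1 μ h x t - h1 μ h y t - Udist μ h t

/-- The population `p`-U-quantile `U⁻¹(p)`. -/
def Uinv (μ : Measure ℝ) (h : ℝ → ℝ → ℝ → ℝ) (p : ℝ) : ℝ := sInf {t | p ≤ Udist μ h t}

/-- The empirical `p`-U-quantile `U_n⁻¹(p)`. -/
def UinvEmp (X : ℤ → Ω → ℝ) (h : ℝ → ℝ → ℝ → ℝ) (n : ℕ) (p : ℝ) (ω : Ω) : ℝ :=
  sInf {t | p ≤ Ustat X h n t ω}

/-- The variation condition for `h(·,·,t)` with constant `L`, with respect to the law `μ`. -/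
def VariationAt (μ : Measure ℝ) (h : ℝ → ℝ → ℝ → ℝ) (L t : ℝ) : Prop :=
  ∀ ε > (0 : ℝ),
    ∫⁻ q : ℝ × ℝ, ENNReal.ofReal
        ((⨆ r ∈ Metric.closedBall q ε, |h r.1 r.2 t - h q.1 q.2 t|) ^ 2) ∂(μ.prod μ)
      ≤ ENNReal.ofReal (L * ε)

/-- Assumption 2: the variation condition holds for all `t` in a neighborhood of `U⁻¹(p)`. -/
def Assumption2 (μ : Measure ℝ) (h : ℝ → ℝ → ℝ → ℝ) (p : ℝ) : Prop :=
  ∃ L δ : ℝ, 0 < δ ∧ ∀ t, |t - Uinv μ h p| < δ → VariationAt μ h L t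

/-- Assumption 3: `U` is differentiable near `U⁻¹(p)` with derivative `u`,
`u(U⁻¹(p)) > 0`, and a `3/2`-order Taylor-type expansion holds at `U⁻¹(p)`. -/
def Assumption3 (μ : Measure ℝ) (h : ℝ → ℝ → ℝ → ℝ) (p : ℝ) (u : ℝ → ℝ) : Prop :=
  (∀ᶠ t in 𝓝 (Uinv μ h p), HasDerivAt (Udist μ h) (u t) t) ∧
    0 < u (Uinv μ h p) ∧
    (fun t => Udist μ h t - p - u (Uinv μ h p) * (t - Uinv μ h p)) =o[𝓝 (Uinv μ h p)]
      fun t => |t - Uinv μ h p| ^ ((3 : ℝ) / 2)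

/-- The lag-`r` autocovariance `Cov(f(X_0), f(X_r))`. -/
def covShift (P : Measure Ω) (X : ℤ → Ω → ℝ) (f : ℝ → ℝ) (r : ℤ) : ℝ :=
  (∫ ω, f (X 0 ω) * f (X r ω) ∂P) - (∫ ω, f (X 0 ω) ∂P) * ∫ ω, f (X r ω) ∂P

/-- The long-run variance `σ_p²` of the `p`-U-quantile. -/
def lrv (P : Measure Ω) (X : ℤ → Ω → ℝ) (h : ℝ → ℝ → ℝ → ℝ) (p : ℝ) (u : ℝ → ℝ) : ℝ :=
  (4 / u (Uinv (P.map (X 0)) h p) ^ 2) *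
    ∑' r : ℤ, covShift P X (fun x => h1 (P.map (X 0)) h x (Uinv (P.map (X 0)) h p)) r

end UQuantile

open MeasureTheory Filter Set
open scoped ENNReal NNReal Topology BigOperators

noncomputable section
namespace UQuantile
variable {Ω : Type*} [MeasurableSpace Ω]

/-- The indicator kernel `h(x,y,t) = 1{g(x,y) ≤ t}`. -/
def hInd (g : ℝ → ℝ → ℝ) (x y t : ℝ) : ℝ := if g x y ≤ t then 1 else 0

/-- Kernel density estimator of the U-statistic density. -/
def uhat (X : ℤ → Ω → ℝ) (g : ℝ → ℝ → ℝ) (K : ℝ → ℝ) (d : ℕ → ℝ) (n : ℕ) (t : ℝ)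
    (ω : Ω) : ℝ :=
  (2 / ((n : ℝ) * ((n : ℝ) - 1) * d n)) *
    ∑ i ∈ Finset.Icc (1 : ℤ) (n : ℤ), ∑ j ∈ Finset.Ioc i (n : ℤ),
      K ((g (X i ω) (X j ω) - t) / d n)

/-- Empirical version `ĥ₁(x, t)` of `h₁(x, t)`. -/
def h1hat (X : ℤ → Ω → ℝ) (g : ℝ → ℝ → ℝ) (n : ℕ) (x t : ℝ) (ω : Ω) : ℝ :=
  ((n : ℝ)⁻¹ * ∑ i ∈ Finset.Icc (1 : ℤ) (n : ℤ), hInd g x (X i ω) t) -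
    ((n : ℝ)⁻¹ ^ 2 *
      ∑ i ∈ Finset.Icc (1 : ℤ) (n : ℤ), ∑ j ∈ Finset.Icc (1 : ℤ) (n : ℤ),
        hInd g (X i ω) (X j ω) t)

/-- Sample lag-`r` autocovariance `ρ̂(r, t)` of `(ĥ₁(X_i, t))_i`. -/
def rhohat (X : ℤ → Ω → ℝ) (g : ℝ → ℝ → ℝ) (n r : ℕ) (t : ℝ) (ω : Ω) : ℝ :=
  (n : ℝ)⁻¹ * ∑ i ∈ Finset.Icc (1 : ℤ) ((n : ℤ) - (r : ℤ)),
    h1hat X g n (X i ω) t ω * h1hat X g n (X (i + (r : ℤ)) ω) t ω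

/-- The HAC long-run variance estimator `σ̂²_{p,n}`. -/
def sigma2hat (X : ℤ → Ω → ℝ) (g : ℝ → ℝ → ℝ) (K W : ℝ → ℝ) (d b : ℕ → ℝ) (n : ℕ)
    (p : ℝ) (ω : Ω) : ℝ :=
  (4 / uhat X g K d n (UinvEmp X (hInd g) n p ω) ω ^ 2) *
    ∑ r ∈ Finset.Icc (-(n : ℤ) + 1) ((n : ℤ) - 1),
      W ((r.natAbs : ℝ) / b n) * rhohat X g n r.natAbs (UinvEmp X (hInd g) n p ω) ω

/-- Assumption 4: conditions on the density kernel `K` and the bandwidth `d_n`. -/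
structure Assumption4 (K : ℝ → ℝ) (d : ℕ → ℝ) : Prop where
  symm : ∀ x, K (-x) = K x
  lipschitz : ∃ c : ℝ≥0, LipschitzWith c K
  compact_support : HasCompactSupport K
  bounded_variation : BoundedVariationOn K univ
  integral_one : ∫ x, K x = 1
  d_pos : ∀ n, 0 < d n
  d_to_zero : Tendsto d atTop (𝓝 0)
  nd_to_top : Tendsto (fun n : ℕ => (n : ℝ) * d n ^ ((8 : ℝ) / 3)) atTop atTop

/-- Assumption 5: conditions on the HAC kernel `W` and the bandwidth `b_n`. -/
structure Assumption5 (W : ℝ → ℝ) (b : ℕ → ℝ) : Prop where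
  range : ∀ x ≥ (0 : ℝ), 0 ≤ W x ∧ W x < 1
  cont_zero : ContinuousWithinAt W (Ici 0) 0
  cont : ∃ S : Finset ℝ, ∀ x ≥ (0 : ℝ), x ∉ S → ContinuousWithinAt W (Ici 0) x
  dominated : ∃ Wb : ℝ → ℝ, AntitoneOn Wb (Ici 0) ∧ IntegrableOn Wb (Ici 0) ∧
      ∀ x ≥ (0 : ℝ), |W x| ≤ Wb x
  fourier : IntegrableOn (fun x => |∫ t in Ioi (0 : ℝ), W t * Real.cos (x * t)|) (Ioi 0)
  b_pos : ∀ n, 0 < b n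
  b_top : Tendsto b atTop atTop
  b_sqrt : Tendsto (fun n : ℕ => b n / Real.sqrt n) atTop (𝓝 0)

/-- Assumption 6: the variation condition for the kernel `g`. -/
def Assumption6 (μ : Measure ℝ) (g : ℝ → ℝ → ℝ) : Prop :=
  ∃ L : ℝ, ∀ ε > (0 : ℝ),
    ∫⁻ q : ℝ × ℝ, ENNReal.ofReal
        ((⨆ r ∈ Metric.closedBall q ε, |g r.1 r.2 - g q.1 q.2|) ^ 2) ∂(μ.prod μ)
      ≤ ENNReal.ofReal (L * ε)

end UQuantile

namespace UQuantile


section PartAWrap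

/-- Two measures differ by at most `δ` on every measurable set. -/
def Close {α : Type*} [MeasurableSpace α] (ν₁ ν₂ : Measure α) (δ : ℝ) : Prop :=
  ∀ E, MeasurableSet E → |ν₁.real E - ν₂.real E| ≤ δ

lemma Close.trans {α : Type*} [MeasurableSpace α] {ν₁ ν₂ ν₃ : Measure α} {δ δ' : ℝ}
    (h : Close ν₁ ν₂ δ) (h' : Close ν₂ ν₃ δ') : Close ν₁ ν₃ (δ + δ') := fun E hE => by
  have := abs_sub_le (ν₁.real E) (ν₂.real E) (ν₃.real E)
  linarith [h E hE, h' E hE]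

lemma Close.map {α γ : Type*} [MeasurableSpace α] [MeasurableSpace γ] {ν₁ ν₂ : Measure α} {δ : ℝ}
    (h : Close ν₁ ν₂ δ) {f : α → γ} (hf : Measurable f) :
    Close (ν₁.map f) (ν₂.map f) δ := fun E hE => by
  rw [map_measureReal_apply hf hE, map_measureReal_apply hf hE]
  exact h _ (hf hE)

lemma Close.prod {α γ : Type*} [MeasurableSpace α] [MeasurableSpace γ] {ν₁ ν₂ : Measure γ} {δ : ℝ}
    (η : Measure α) [IsProbabilityMeasure η] [IsProbabilityMeasure ν₁] [IsProbabilityMeasure ν₂]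
    (h : Close ν₁ ν₂ δ) : Close (η.prod ν₁) (η.prod ν₂) δ := fun E hE => by
  have key : ∀ (ν : Measure γ) [IsProbabilityMeasure ν],
      (η.prod ν).real E = ∫ x, ν.real (Prod.mk x ⁻¹' E) ∂η ∧
        Integrable (fun x => ν.real (Prod.mk x ⁻¹' E)) η := by
    intro ν _
    have hm : Measurable (fun x => ν (Prod.mk x ⁻¹' E)) := measurable_measure_prodMk_left hE
    constructor
    · rw [measureReal_def, Measure.prod_apply hE]
      simp only [measureReal_def]
      rw [integral_toReal hm.aemeasurable]
      exact Eventually.of_forall fun x => measure_lt_top _ _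
    · refine Integrable.of_bound (C := 1) hm.ennreal_toReal.aestronglyMeasurable ?_
      refine Eventually.of_forall fun x => ?_
      rw [Real.norm_eq_abs, abs_of_nonneg measureReal_nonneg]
      exact measureReal_le_one
  rw [(key ν₁).1, (key ν₂).1, ← integral_sub (key ν₁).2 (key ν₂).2, ← Real.norm_eq_abs]
  refine (norm_integral_le_of_norm_le_const (C := δ) (Eventually.of_forall fun x => ?_)).trans ?_
  · exact h _ (measurable_prodMk_left hE)
  · simp

/-- Sets of the form `{q | (a q.1, b q.2) ∈ S}` with finitely valued `a`, `b`. -/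
def rectAlg (α γ : Type*) [MeasurableSpace α] [MeasurableSpace γ] : Set (Set (α × γ)) :=
  {E | ∃ (m m' : ℕ) (a : α → Fin m) (b : γ → Fin m') (S : Set (Fin m × Fin m')),
    Measurable a ∧ Measurable b ∧ E = {q | (a q.1, b q.2) ∈ S}}

lemma rectAlg_isSetAlgebra (α γ : Type*) [MeasurableSpace α] [MeasurableSpace γ] :
    IsSetAlgebra (rectAlg α γ) where
  empty_mem := ⟨1, 1, fun _ => 0, fun _ => 0, ∅, by fun_prop, by fun_prop, by simp⟩
  compl_mem := by
    rintro s ⟨m, m', a, b, S, ha, hb, rfl⟩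
    exact ⟨m, m', a, b, Sᶜ, ha, hb, by ext; simp⟩
  union_mem := by
    rintro s t ⟨m, m', a, b, S, ha, hb, rfl⟩ ⟨k, k', c, d, T, hc, hd, rfl⟩
    refine ⟨m * k, m' * k', fun x => finProdFinEquiv (a x, c x),
      fun y => finProdFinEquiv (b y, d y),
      {q | ((finProdFinEquiv.symm q.1).1, (finProdFinEquiv.symm q.2).1) ∈ S ∨
        ((finProdFinEquiv.symm q.1).2, (finProdFinEquiv.symm q.2).2) ∈ T}, ?_, ?_, ?_⟩
    · exact (measurable_of_finite _).comp (ha.prodMk hc)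
    · exact (measurable_of_finite _).comp (hb.prodMk hd)
    · ext q
      simp only [mem_union, Set.mem_ofPred_eq, Equiv.symm_apply_apply]

lemma rectAlg_generate (α γ : Type*) [MeasurableSpace α] [MeasurableSpace γ] :
    (inferInstance : MeasurableSpace (α × γ)) = MeasurableSpace.generateFrom (rectAlg α γ) := by
  classical
  apply le_antisymm
  · rw [show (inferInstance : MeasurableSpace (α × γ)) = _ from generateFrom_prod.symm]
    apply MeasurableSpace.generateFrom_mono
    rintro _ ⟨s, hs, t, ht, rfl⟩
    refine ⟨2, 2, fun x => if x ∈ s then 1 else 0, fun x => if x ∈ t then 1 else 0, {(1, 1)},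
      Measurable.ite hs measurable_const measurable_const,
      Measurable.ite ht measurable_const measurable_const, ?_⟩
    ext q
    by_cases h1 : q.1 ∈ s <;> by_cases h2 : q.2 ∈ t <;> simp [h1, h2]
  · apply MeasurableSpace.generateFrom_le
    rintro _ ⟨m, m', a, b, S, ha, hb, rfl⟩
    exact ((ha.comp measurable_fst).prodMk (hb.comp measurable_snd)) (Set.toFinite S).measurableSet

lemma close_of_dense {α : Type*} [m : MeasurableSpace α] (ν₁ ν₂ : Measure α)
    [IsProbabilityMeasure ν₁] [IsProbabilityMeasure ν₂] (𝒜 : Set (Set α)) (δ : ℝ)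
    (h𝒜 : IsSetAlgebra 𝒜) (hgen : m = MeasurableSpace.generateFrom 𝒜)
    (h : ∀ E ∈ 𝒜, |ν₁.real E - ν₂.real E| ≤ δ) : Close ν₁ ν₂ δ := by
  intro E hE
  refine le_of_forall_pos_le_add fun ε hε => ?_
  have hd := Measure.MeasureDense.of_generateFrom_isSetAlgebra_finite (μ := ν₁ + ν₂) h𝒜 hgen
  obtain ⟨t, ht, hlt⟩ := hd.approx E hE (measure_ne_top _ _) ε hε
  have htm := hd.measurable t ht
  have h1 : (ν₁ + ν₂).real (symmDiff E t) < ε :=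
    (ENNReal.lt_ofReal_iff_toReal_lt (measure_ne_top _ _)).1 hlt
  rw [measureReal_add_apply] at h1
  have k : ∀ (ν : Measure α) [IsProbabilityMeasure ν],
      |ν.real E - ν.real t| ≤ ν.real (symmDiff E t) := fun ν _ =>
    abs_measureReal_sub_le_measureReal_symmDiff hE.nullMeasurableSet htm.nullMeasurableSet
  have := k ν₁
  have := k ν₂
  have := h t ht
  simp only [abs_le] at *
  constructor <;> linarith

lemma close_of_beta {Ω α γ : Type*} [MeasurableSpace Ω] [MeasurableSpace α] [MeasurableSpace γ]
    (P : Measure Ω) [IsProbabilityMeasure P] (Z : ℤ → Ω → ℝ) (β : ℕ → ℝ)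
    (hβ : IsBetaBound P Z β) (k : ℕ) (V : Ω → α) (Y : Ω → γ)
    (hV : Measurable V) (hY : Measurable Y)
    (hVp : @Measurable Ω α (pastSigma Z) _ V) (hYf : @Measurable Ω γ (futureSigma Z k) _ Y) :
    Close (P.map fun ω => (V ω, Y ω)) ((P.map V).prod (P.map Y)) (2 * β k) := by
  classical
  have := Measure.isProbabilityMeasure_map (μ := P) hV.aemeasurable
  have := Measure.isProbabilityMeasure_map (μ := P) hY.aemeasurable
  have := Measure.isProbabilityMeasure_map (μ := P) (hV.prodMk hY).aemeasurable
  refine close_of_dense _ _ _ _ (rectAlg_isSetAlgebra α γ) (rectAlg_generate α γ) ?_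
  rintro _ ⟨m, m', a, b, S, ha, hb, rfl⟩
  have hmeas : ∀ q : Fin m × Fin m', MeasurableSet ((a ⁻¹' {q.1}) ×ˢ (b ⁻¹' {q.2})) := fun q =>
    (ha (measurableSet_singleton _)).prod (hb (measurableSet_singleton _))
  have hE : {q : α × γ | (a q.1, b q.2) ∈ S} =
      ⋃ q ∈ S.toFinset, (a ⁻¹' {q.1}) ×ˢ (b ⁻¹' {q.2}) := by
    ext q
    simp
  have hdis : Set.PairwiseDisjoint (↑S.toFinset : Set (Fin m × Fin m'))
      (fun q => (a ⁻¹' {q.1}) ×ˢ (b ⁻¹' {q.2})) := by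
    intro q _ q' _ hne
    rw [Function.onFun, Set.disjoint_left]
    rintro x ⟨h1, h2⟩ ⟨h3, h4⟩
    apply hne
    simp only [mem_preimage, mem_singleton_iff] at h1 h2 h3 h4
    exact Prod.ext (h1.symm.trans h3) (h2.symm.trans h4)
  rw [hE, measureReal_biUnion_finset hdis (fun q _ => hmeas q),
    measureReal_biUnion_finset hdis (fun q _ => hmeas q), ← Finset.sum_sub_distrib]
  have hb2 := hβ k m m' (fun i => V ⁻¹' (a ⁻¹' {i})) (fun j => Y ⁻¹' (b ⁻¹' {j}))
    (fun i => hVp (ha (measurableSet_singleton _)))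
    (fun i => hYf (hb (measurableSet_singleton _)))
    (by
      intro i j hij
      rw [Function.onFun, Set.disjoint_left]
      intro x h1 h2
      exact hij (h1.symm.trans h2))
    (by
      intro i j hij
      rw [Function.onFun, Set.disjoint_left]
      intro x h1 h2
      exact hij (h1.symm.trans h2))
    (by ext; simp) (by ext; simp)
  refine (Finset.abs_sum_le_sum_abs _ _).trans ?_
  refine (Finset.sum_le_sum_of_subset_of_nonneg (Finset.subset_univ _)
    (fun _ _ _ => abs_nonneg _)).trans ?_
  rw [Fintype.sum_prod_type]
  refine le_trans (le_of_eq ?_) (show (2 : ℝ) * ((1 / 2 : ℝ) * _) ≤ _ from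
    mul_le_mul_of_nonneg_left hb2 (by norm_num))
  rw [← mul_assoc]
  norm_num
  refine Finset.sum_congr rfl fun i _ => Finset.sum_congr rfl fun j _ => ?_
  rw [map_measureReal_apply (hV.prodMk hY) (hmeas (i, j)),
    map_measureReal_apply hV (ha (measurableSet_singleton _)),
    map_measureReal_apply hY (hb (measurableSet_singleton _))]
  rfl

end PartAWrap

section PartBWrap

/-- The approximating process `Y_i = f_l(Z_{i-l}, …, Z_{i+l})`. -/
def approxY {Ω : Type*} (Z : ℤ → Ω → ℝ) (l : ℕ) (f : (Fin (2 * l + 1) → ℝ) → ℝ) (i : ℤ) (ω : Ω) :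
    ℝ :=
  f fun j => Z (((j : ℕ) : ℤ) - (l : ℤ) + i) ω

lemma measurable_approxY {Ω : Type*} [MeasurableSpace Ω] {Z : ℤ → Ω → ℝ}
    (hZ : ∀ i, Measurable (Z i)) (l : ℕ) {f : (Fin (2 * l + 1) → ℝ) → ℝ} (hf : Measurable f)
    (i : ℤ) : Measurable (approxY Z l f i) :=
  hf.comp (measurable_pi_lambda _ fun _ => hZ _)

lemma approxY_past {Ω : Type*} {Z : ℤ → Ω → ℝ}
    (l : ℕ) {f : (Fin (2 * l + 1) → ℝ) → ℝ} (hf : Measurable f)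
    (i : ℤ) (hi : i + l ≤ 0) : @Measurable Ω ℝ (pastSigma Z) _ (approxY Z l f i) := by
  refine hf.comp (@measurable_pi_lambda _ _ _ (pastSigma Z) _ _ fun j => ?_)
  have hj := j.2
  have : MeasurableSpace.comap (Z (((j : ℕ) : ℤ) - (l : ℤ) + i)) Real.measurableSpace
      ≤ pastSigma Z :=
    le_iSup (fun i : {i : ℤ // i ≤ 0} => MeasurableSpace.comap (Z i) Real.measurableSpace)
      ⟨((j : ℕ) : ℤ) - (l : ℤ) + i, by omega⟩
  exact measurable_iff_comap_le.2 this

lemma approxY_future {Ω : Type*} {Z : ℤ → Ω → ℝ}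
    (l k : ℕ) {f : (Fin (2 * l + 1) → ℝ) → ℝ} (hf : Measurable f)
    (i : ℤ) (hi : (k : ℤ) ≤ i - l) : @Measurable Ω ℝ (futureSigma Z k) _ (approxY Z l f i) := by
  refine hf.comp (@measurable_pi_lambda _ _ _ (futureSigma Z k) _ _ fun j => ?_)
  have : MeasurableSpace.comap (Z (((j : ℕ) : ℤ) - (l : ℤ) + i)) Real.measurableSpace
      ≤ futureSigma Z k :=
    le_iSup (fun i : {i : ℤ // (k : ℤ) ≤ i} => MeasurableSpace.comap (Z i) Real.measurableSpace)
      ⟨((j : ℕ) : ℤ) - (l : ℤ) + i, by omega⟩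
  exact measurable_iff_comap_le.2 this

lemma stat_fintype {Ω : Type*} [MeasurableSpace Ω] {P : Measure Ω}
    {X Z : ℤ → Ω → ℝ} (hX : ∀ i, Measurable (X i)) (hZ : ∀ i, Measurable (Z i))
    (hs : IsPairStationary P X Z) {ι : Type*} [Fintype ι] (k : ℤ) (idx : ι → ℤ) :
    P.map (fun ω i => (X (idx i) ω, Z (idx i) ω)) =
      P.map (fun ω i => (X (idx i + k) ω, Z (idx i + k) ω)) := by
  have e := Fintype.equivFin ι
  have h := hs k (Fintype.card ι) (fun i => idx (e.symm i))
  have h2 := congrArg (Measure.map (fun (q : Fin (Fintype.card ι) → ℝ × ℝ) (i : ι) => q (e i))) h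
  rw [Measure.map_map (measurable_pi_lambda _ fun _ => measurable_pi_apply _)
      (measurable_pi_lambda _ fun _ => (hX _).prodMk (hZ _)),
    Measure.map_map (measurable_pi_lambda _ fun _ => measurable_pi_apply _)
      (measurable_pi_lambda _ fun _ => (hX _).prodMk (hZ _))] at h2
  simpa [Function.comp_def] using h2

lemma stat_approx {Ω : Type*} [MeasurableSpace Ω] {P : Measure Ω}
    {X Z : ℤ → Ω → ℝ} (hX : ∀ i, Measurable (X i)) (hZ : ∀ i, Measurable (Z i))
    (hs : IsPairStationary P X Z) (l : ℕ) {f : (Fin (2 * l + 1) → ℝ) → ℝ} (hf : Measurable f) :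
    IsPairStationary P X (approxY Z l f) := by
  intro k N idx
  have h := stat_fintype hX hZ hs (ι := (Fin N × Fin (2 * l + 1)) ⊕ Fin N) k
    (Sum.elim (fun q => ((q.2 : ℕ) : ℤ) - (l : ℤ) + idx q.1) idx)
  have hΦ : Measurable (fun (q : (Fin N × Fin (2 * l + 1)) ⊕ Fin N → ℝ × ℝ) (a : Fin N) =>
      ((q (Sum.inr a)).1, f fun j => (q (Sum.inl (a, j))).2)) := by
    refine measurable_pi_lambda _ fun a => Measurable.prodMk ?_ (hf.comp ?_)
    · exact measurable_fst.comp (measurable_pi_apply _)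
    · exact measurable_pi_lambda _ fun j => measurable_snd.comp (measurable_pi_apply _)
  have h2 := congrArg (Measure.map (fun (q : (Fin N × Fin (2 * l + 1)) ⊕ Fin N → ℝ × ℝ)
    (a : Fin N) => ((q (Sum.inr a)).1, f fun j => (q (Sum.inl (a, j))).2))) h
  rw [Measure.map_map hΦ (measurable_pi_lambda _ fun _ => (hX _).prodMk (hZ _)),
    Measure.map_map hΦ (measurable_pi_lambda _ fun _ => (hX _).prodMk (hZ _))] at h2
  simpa [Function.comp_def, approxY, add_assoc] using h2

section
variable {Ω : Type*} [MeasurableSpace Ω] {P : Measure Ω}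
    {X Y : ℤ → Ω → ℝ}

lemma stat_snd (hX : ∀ i, Measurable (X i)) (hY : ∀ i, Measurable (Y i))
    (hs : IsPairStationary P X Y) {N : ℕ} (k : ℤ) (idx : Fin N → ℤ) :
    P.map (fun ω a => Y (idx a) ω) = P.map (fun ω a => Y (idx a + k) ω) := by
  have h2 := congrArg (Measure.map (fun (q : Fin N → ℝ × ℝ) a => (q a).2)) (hs k N idx)
  have hm : Measurable (fun (q : Fin N → ℝ × ℝ) a => (q a).2) :=
    measurable_pi_lambda _ fun a => measurable_snd.comp (measurable_pi_apply _)
  rwa [Measure.map_map hm (measurable_pi_lambda _ fun _ => (hX _).prodMk (hY _)),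
    Measure.map_map hm (measurable_pi_lambda _ fun _ => (hX _).prodMk (hY _))] at h2

lemma stat_pair (hX : ∀ i, Measurable (X i)) (hY : ∀ i, Measurable (Y i))
    (hs : IsPairStationary P X Y) (i : ℤ) :
    P.map (fun ω => (X i ω, Y i ω)) = P.map (fun ω => (X 0 ω, Y 0 ω)) := by
  have h2 := congrArg (Measure.map (fun (q : Fin 1 → ℝ × ℝ) => q 0)) (hs i 1 (fun _ => 0))
  have hm : Measurable (fun (q : Fin 1 → ℝ × ℝ) => q 0) := measurable_pi_apply _
  rw [Measure.map_map hm (measurable_pi_lambda _ fun _ => (hX _).prodMk (hY _)),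
    Measure.map_map hm (measurable_pi_lambda _ fun _ => (hX _).prodMk (hY _))] at h2
  simpa [Function.comp_def] using h2.symm

lemma stat_one (hX : ∀ i, Measurable (X i)) (hY : ∀ i, Measurable (Y i))
    (hs : IsPairStationary P X Y) (i : ℤ) : P.map (Y i) = P.map (Y 0) := by
  have h2 := congrArg (Measure.map Prod.snd) (stat_pair hX hY hs i)
  rwa [Measure.map_map measurable_snd ((hX _).prodMk (hY _)),
    Measure.map_map measurable_snd ((hX _).prodMk (hY _))] at h2

end

lemma close_sorted {Ω : Type*} [MeasurableSpace Ω] {P : Measure Ω} [IsProbabilityMeasure P]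
    {X Z : ℤ → Ω → ℝ} (hX : ∀ i, Measurable (X i)) (hZ : ∀ i, Measurable (Z i))
    (hs : IsPairStationary P X Z) (l : ℕ) {f : (Fin (2 * l + 1) → ℝ) → ℝ} (hf : Measurable f)
    {β : ℕ → ℝ} (hβ : IsBetaBound P Z β) (N : ℕ) :
    ∀ s : Fin N → ℤ, (∀ a b, a < b → s a + 3 * l ≤ s b) →
      Close (P.map fun ω a => approxY Z l f (s a) ω)
        (Measure.pi fun _ => P.map (approxY Z l f 0)) (N * (2 * β l)) := by
  have hYm := measurable_approxY hZ l hf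
  have hst := stat_approx hX hZ hs l hf
  have := Measure.isProbabilityMeasure_map (μ := P) (hYm 0).aemeasurable
  induction N with
  | zero =>
    intro s _ E hE
    have := Measure.isProbabilityMeasure_map (μ := P)
      (measurable_pi_lambda (fun ω a => approxY Z l f (s a) ω) (fun a => hYm _)).aemeasurable
    rcases Set.eq_empty_or_nonempty E with h | ⟨x, hx⟩
    · simp [h]
    · have h : E = univ := eq_univ_of_forall fun y => Subsingleton.elim x y ▸ hx
      simp [h]
  | succ N ih =>
    intro s hsep
    set c : ℤ := -(s 0 + l)
    rw [stat_snd hX hYm hst c s]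
    set V : Ω → ℝ := approxY Z l f (s 0 + c)
    set T : Ω → Fin N → ℝ := fun ω a => approxY Z l f (s a.succ + c) ω
    have hT : Measurable T := measurable_pi_lambda _ fun a => hYm _
    have := Measure.isProbabilityMeasure_map (μ := P) hT.aemeasurable
    have h1 : Close (P.map fun ω => (V ω, T ω)) ((P.map V).prod (P.map T)) (2 * β l) := by
      refine close_of_beta P Z β hβ l V T (hYm _) hT (approxY_past l hf _ (by simp [c])) ?_
      refine @measurable_pi_lambda _ _ _ (futureSigma Z l) _ _ fun a => ?_
      refine approxY_future l l hf _ ?_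
      have := hsep 0 a.succ (Fin.succ_pos a)
      simp only [c]
      linarith
    have h2 := ih (fun a => s a.succ + c) (fun a b hab => by
      have := hsep a.succ b.succ (Fin.succ_lt_succ_iff.2 hab)
      linarith)
    rw [show P.map V = P.map (approxY Z l f 0) from stat_one hX hYm hst _] at h1
    have h3 := h1.trans (Close.prod (P.map (approxY Z l f 0)) h2)
    have hmp := (measurePreserving_piFinSuccAbove
      (fun _ : Fin (N + 1) => P.map (approxY Z l f 0)) 0).symm
    have h4 := h3.map hmp.measurable
    rw [hmp.map_eq, Measure.map_map hmp.measurable ((hYm _).prodMk hT)] at h4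
    convert h4 using 1
    · congr 1
      ext ω a
      refine Fin.cases ?_ (fun a => ?_) a
      · simp [MeasurableEquiv.piFinSuccAbove]
      · simp [T, MeasurableEquiv.piFinSuccAbove]
    · push_cast; ring

lemma pi_perm {N : ℕ} (η : Measure ℝ) [IsProbabilityMeasure η] (σ : Equiv.Perm (Fin N)) :
    (Measure.pi fun _ : Fin N => η).map (fun q a => q (σ a)) = Measure.pi fun _ => η := by
  refine (Measure.pi_eq fun s hs => ?_).symm
  have hm : Measurable (fun (q : Fin N → ℝ) a => q (σ a)) :=
    measurable_pi_lambda _ fun a => measurable_pi_apply _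
  rw [Measure.map_apply hm (MeasurableSet.univ_pi hs)]
  have : (fun (q : Fin N → ℝ) a => q (σ a)) ⁻¹' (univ.pi s) = univ.pi (fun a => s (σ.symm a)) := by
    ext q
    simp only [mem_preimage, mem_univ_pi]
    exact ⟨fun h a => by simpa using h (σ.symm a), fun h a => by simpa using h (σ a)⟩
  rw [this, Measure.pi_pi]
  exact Equiv.prod_comp σ.symm (fun a => η (s a))

lemma close_sep {Ω : Type*} [MeasurableSpace Ω] {P : Measure Ω} [IsProbabilityMeasure P]
    {X Z : ℤ → Ω → ℝ} (hX : ∀ i, Measurable (X i)) (hZ : ∀ i, Measurable (Z i))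
    (hs : IsPairStationary P X Z) (l : ℕ) {f : (Fin (2 * l + 1) → ℝ) → ℝ} (hf : Measurable f)
    {β : ℕ → ℝ} (hβ : IsBetaBound P Z β) (N : ℕ) (s : Fin N → ℤ)
    (hsep : ∀ a b, a ≠ b → 3 * (l : ℤ) ≤ |s a - s b|) :
      Close (P.map fun ω a => approxY Z l f (s a) ω)
        (Measure.pi fun _ => P.map (approxY Z l f 0)) (N * (2 * β l)) := by
  have hYm := measurable_approxY hZ l hf
  have := Measure.isProbabilityMeasure_map (μ := P) (hYm 0).aemeasurable
  set σ := Tuple.sort s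
  have hmono := Tuple.monotone_sort s
  have h := close_sorted hX hZ hs l hf hβ N (fun a => s (σ a)) (fun a b hab => by
    have h1 : s (σ a) ≤ s (σ b) := hmono hab.le
    have h2 := hsep (σ a) (σ b) (fun h => hab.ne (σ.injective h))
    rw [abs_of_nonpos (by linarith)] at h2
    linarith)
  have hm : Measurable (fun (q : Fin N → ℝ) a => q (σ.symm a)) :=
    measurable_pi_lambda _ fun a => measurable_pi_apply _
  have h2 := h.map hm
  rw [pi_perm, Measure.map_map hm (measurable_pi_lambda _ fun a => hYm _)] at h2
  simpa [Function.comp_def] using h2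

lemma pi_two (η : Measure ℝ) [IsProbabilityMeasure η] (N : ℕ) (a b : Fin N) (hab : a ≠ b) :
    (Measure.pi fun _ : Fin N => η).map (fun q => (q a, q b)) = η.prod η := by
  have hi : ProbabilityTheory.iIndepFun (fun (i : Fin N) (q : Fin N → ℝ) => q i)
      (Measure.pi fun _ : Fin N => η) :=
    ProbabilityTheory.iIndepFun_pi (X := fun _ x => x) (fun _ => aemeasurable_id)
  have h := (hi.indepFun hab).map_prod_eq_prod_map_map (measurable_pi_apply a).aemeasurable
    (measurable_pi_apply b).aemeasurable
  rw [h]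
  have e1 := (measurePreserving_eval (fun _ : Fin N => η) a).map_eq
  have e2 := (measurePreserving_eval (fun _ : Fin N => η) b).map_eq
  exact congrArg₂ Measure.prod e1 e2

lemma pi_four (η : Measure ℝ) [IsProbabilityMeasure η] :
    (Measure.pi fun _ : Fin 4 => η).map (fun q => ((q 0, q 1), (q 2, q 3))) =
      (η.prod η).prod (η.prod η) := by
  have hi : ProbabilityTheory.iIndepFun (fun (i : Fin 4) (q : Fin 4 → ℝ) => q i)
      (Measure.pi fun _ : Fin 4 => η) :=
    ProbabilityTheory.iIndepFun_pi (X := fun _ x => x) (fun _ => aemeasurable_id)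
  have h := (hi.indepFun_prodMk_prodMk (fun i => measurable_pi_apply i) 0 1 2 3 (by decide)
    (by decide) (by decide) (by decide)).map_prod_eq_prod_map_map
      ((measurable_pi_apply 0).prodMk (measurable_pi_apply 1)).aemeasurable
      ((measurable_pi_apply 2).prodMk (measurable_pi_apply 3)).aemeasurable
  rw [h, pi_two η 4 0 1 (by decide), pi_two η 4 2 3 (by decide)]

lemma pair_close {Ω : Type*} [MeasurableSpace Ω] {P : Measure Ω} [IsProbabilityMeasure P]
    {X Z : ℤ → Ω → ℝ} (hX : ∀ i, Measurable (X i)) (hZ : ∀ i, Measurable (Z i))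
    (hs : IsPairStationary P X Z) (l : ℕ) {f : (Fin (2 * l + 1) → ℝ) → ℝ} (hf : Measurable f)
    {β : ℕ → ℝ} (hβ : IsBetaBound P Z β) (i j : ℤ) (hij : 3 * (l : ℤ) ≤ |i - j|)
    (A : Set (ℝ × ℝ)) (hA : MeasurableSet A) :
    |P.real {ω | (approxY Z l f i ω, approxY Z l f j ω) ∈ A} -
      ((P.map (approxY Z l f 0)).prod (P.map (approxY Z l f 0))).real A| ≤ 4 * β l := by
  have hYm := measurable_approxY hZ l hf
  have := Measure.isProbabilityMeasure_map (μ := P) (hYm 0).aemeasurable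
  have h := close_sep hX hZ hs l hf hβ 2 ![i, j] (by
    intro a b hab
    fin_cases a <;> fin_cases b <;> simp_all [abs_sub_comm])
  have hm : Measurable (fun (q : Fin 2 → ℝ) => (q 0, q 1)) :=
    (measurable_pi_apply 0).prodMk (measurable_pi_apply 1)
  have h2 := h.map hm A hA
  rw [pi_two _ _ _ _ (by decide), Measure.map_map hm (measurable_pi_lambda _ fun a => hYm _),
    map_measureReal_apply (hm.comp (measurable_pi_lambda _ fun a => hYm _)) hA] at h2
  refine le_trans (le_of_eq ?_) (h2.trans (le_of_eq (by push_cast; ring)))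
  rfl

lemma quad_close {Ω : Type*} [MeasurableSpace Ω] {P : Measure Ω} [IsProbabilityMeasure P]
    {X Z : ℤ → Ω → ℝ} (hX : ∀ i, Measurable (X i)) (hZ : ∀ i, Measurable (Z i))
    (hs : IsPairStationary P X Z) (l : ℕ) {f : (Fin (2 * l + 1) → ℝ) → ℝ} (hf : Measurable f)
    {β : ℕ → ℝ} (hβ : IsBetaBound P Z β) (s : Fin 4 → ℤ)
    (hsep : ∀ a b, a ≠ b → 3 * (l : ℤ) ≤ |s a - s b|)
    (A : Set (ℝ × ℝ)) (hA : MeasurableSet A) :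
    |P.real ({ω | (approxY Z l f (s 0) ω, approxY Z l f (s 1) ω) ∈ A} ∩
        {ω | (approxY Z l f (s 2) ω, approxY Z l f (s 3) ω) ∈ A}) -
      ((P.map (approxY Z l f 0)).prod (P.map (approxY Z l f 0))).real A ^ 2| ≤ 8 * β l := by
  have hYm := measurable_approxY hZ l hf
  have := Measure.isProbabilityMeasure_map (μ := P) (hYm 0).aemeasurable
  have h := close_sep hX hZ hs l hf hβ 4 s hsep
  have hm : Measurable (fun (q : Fin 4 → ℝ) => ((q 0, q 1), (q 2, q 3))) :=
    ((measurable_pi_apply 0).prodMk (measurable_pi_apply 1)).prodMk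
      ((measurable_pi_apply 2).prodMk (measurable_pi_apply 3))
  have h2 := h.map hm (A ×ˢ A) (hA.prod hA)
  rw [pi_four, Measure.map_map hm (measurable_pi_lambda _ fun a => hYm _),
    map_measureReal_apply (hm.comp (measurable_pi_lambda _ fun a => hYm _)) (hA.prod hA),
    measureReal_prod_prod, ← sq] at h2
  refine le_trans (le_of_eq ?_) (h2.trans (le_of_eq (by push_cast; ring)))
  rfl

end PartBWrap

section PartCWrap

/-- Points of the plane at distance less than `ε` from a point on the other side of `A`. -/
def bdry (ε : ℝ) (A : Set (ℝ × ℝ)) : Set (ℝ × ℝ) :=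
  (A ∩ Metric.thickening ε Aᶜ) ∪ (Aᶜ ∩ Metric.thickening ε A)

lemma measurableSet_bdry (ε : ℝ) {A : Set (ℝ × ℝ)} (hA : MeasurableSet A) :
    MeasurableSet (bdry ε A) :=
  (hA.inter Metric.isOpen_thickening.measurableSet).union
    (hA.compl.inter Metric.isOpen_thickening.measurableSet)

lemma mem_bdry_iff {ε : ℝ} {A : Set (ℝ × ℝ)} {q : ℝ × ℝ} :
    q ∈ bdry ε A ↔ ∃ r, dist q r < ε ∧ ¬ (q ∈ A ↔ r ∈ A) := by
  simp only [bdry, mem_union, mem_inter_iff, mem_compl_iff, Metric.mem_thickening_iff]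
  constructor
  · rintro (⟨h, r, h1, h2⟩ | ⟨h, r, h1, h2⟩)
    · exact ⟨r, h2, by tauto⟩
    · exact ⟨r, h2, by tauto⟩
  · rintro ⟨r, h1, h2⟩
    by_cases hq : q ∈ A
    · exact Or.inl ⟨hq, r, by tauto, h1⟩
    · exact Or.inr ⟨hq, r, by tauto, h1⟩

/-- The set where the indicator kernel is one. -/
def levelSet (g : ℝ → ℝ → ℝ) (t : ℝ) : Set (ℝ × ℝ) := {q | g q.1 q.2 ≤ t}

lemma measurableSet_levelSet {g : ℝ → ℝ → ℝ} (hg : Measurable fun q : ℝ × ℝ => g q.1 q.2) (t : ℝ) :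
    MeasurableSet (levelSet g t) := measurableSet_le hg measurable_const

lemma hInd_nonneg (g : ℝ → ℝ → ℝ) (x y t : ℝ) : 0 ≤ hInd g x y t := by
  unfold hInd; split_ifs <;> norm_num

lemma hInd_le_one (g : ℝ → ℝ → ℝ) (x y t : ℝ) : hInd g x y t ≤ 1 := by
  unfold hInd; split_ifs <;> norm_num

lemma hInd_mono (g : ℝ → ℝ → ℝ) (x y : ℝ) : Monotone (hInd g x y) := by
  intro s t hst
  unfold hInd
  split_ifs with h1 h2 <;> first | (exfalso; linarith) | norm_num

lemma variation_bdry (μ : Measure ℝ) [IsProbabilityMeasure μ] (g : ℝ → ℝ → ℝ)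
    (hg : Measurable fun q : ℝ × ℝ => g q.1 q.2) (L t : ℝ)
    (h : VariationAt μ (hInd g) L t) (ε : ℝ) (hε : 0 < ε) :
    (μ.prod μ).real (bdry ε (levelSet g t)) ≤ max L 0 * ε := by
  have hm := measurableSet_bdry ε (measurableSet_levelSet hg t)
  have h1 : (μ.prod μ) (bdry ε (levelSet g t)) ≤ ENNReal.ofReal (L * ε) := by
    refine le_trans ?_ (h ε hε)
    rw [← lintegral_indicator_one hm]
    refine lintegral_mono fun q => ?_
    by_cases hq : q ∈ bdry ε (levelSet g t)
    · rw [indicator_of_mem hq]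
      obtain ⟨r, hr, hne⟩ := mem_bdry_iff.1 hq
      have hd1 : ∀ r : ℝ × ℝ, |hInd g r.1 r.2 t - hInd g q.1 q.2 t| ≤ 1 := fun r => by
        have := hInd_nonneg g r.1 r.2 t
        have := hInd_nonneg g q.1 q.2 t
        have := hInd_le_one g r.1 r.2 t
        have := hInd_le_one g q.1 q.2 t
        rw [abs_le]; constructor <;> linarith
      have hin : ∀ r : ℝ × ℝ, (⨆ (_ : r ∈ Metric.closedBall q ε),
          |hInd g r.1 r.2 t - hInd g q.1 q.2 t|) ≤ 1 := fun r =>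
        Real.iSup_le (fun _ => hd1 r) zero_le_one
      have hone : (1 : ℝ) ≤ ⨆ r ∈ Metric.closedBall q ε,
          |hInd g r.1 r.2 t - hInd g q.1 q.2 t| := by
        refine le_trans ?_ (le_ciSup (f := fun r : ℝ × ℝ => ⨆ (_ : r ∈ Metric.closedBall q ε),
          |hInd g r.1 r.2 t - hInd g q.1 q.2 t|) ⟨1, by rintro _ ⟨r, rfl⟩; exact hin r⟩ r)
        have hmem : r ∈ Metric.closedBall q ε := by
          rw [Metric.mem_closedBall, dist_comm]; exact hr.le
        simp only [hmem, ciSup_unique]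
        simp only [levelSet, Set.mem_ofPred_eq] at hne
        unfold hInd
        split_ifs with c1 c2 <;> first | (exfalso; tauto) | norm_num
      simp only [Pi.one_apply]
      rw [← ENNReal.ofReal_one]
      exact ENNReal.ofReal_le_ofReal (by nlinarith)
    · rw [indicator_of_notMem hq]
      exact zero_le
  rw [measureReal_def]
  refine ENNReal.toReal_le_of_le_ofReal (by positivity) (h1.trans ?_)
  exact ENNReal.ofReal_le_ofReal (mul_le_mul_of_nonneg_right (le_max_left _ _) hε.le)

lemma prod_transfer {Ω : Type*} [MeasurableSpace Ω] {P : Measure Ω} [IsProbabilityMeasure P]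
    {X Y : Ω → ℝ} (hX : Measurable X) (hY : Measurable Y) {ε δ : ℝ}
    (hδ : P.real {ω | ε < |X ω - Y ω|} ≤ δ) {B B' : Set (ℝ × ℝ)} (hB : MeasurableSet B)
    (hB' : MeasurableSet B')
    (h : ∀ x x' y y' : ℝ, |x - y| ≤ ε → |x' - y'| ≤ ε → (y, y') ∈ B → (x, x') ∈ B') :
    ((P.map Y).prod (P.map Y)).real B ≤ ((P.map X).prod (P.map X)).real B' + 2 * δ := by
  rw [Measure.map_prod_map _ _ hY hY, Measure.map_prod_map _ _ hX hX,
    map_measureReal_apply (hY.prodMap hY) hB, map_measureReal_apply (hX.prodMap hX) hB']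
  have hsub : Prod.map Y Y ⁻¹' B ⊆ (Prod.map X X ⁻¹' B' ∪ ({ω | ε < |X ω - Y ω|} ×ˢ univ)) ∪
      (univ ×ˢ {ω | ε < |X ω - Y ω|}) := by
    rintro ⟨ω, ω'⟩ hω
    by_cases h1 : |X ω - Y ω| ≤ ε
    · by_cases h2 : |X ω' - Y ω'| ≤ ε
      · exact Or.inl (Or.inl (h _ _ _ _ h1 h2 hω))
      · exact Or.inr ⟨trivial, not_le.1 h2⟩
    · exact Or.inl (Or.inr ⟨not_le.1 h1, trivial⟩)
  have h1 := measureReal_mono (μ := P.prod P) hsub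
  have h2 := measureReal_union_le (μ := P.prod P)
    (Prod.map X X ⁻¹' B' ∪ ({ω | ε < |X ω - Y ω|} ×ˢ univ)) (univ ×ˢ {ω | ε < |X ω - Y ω|})
  have h3 := measureReal_union_le (μ := P.prod P)
    (Prod.map X X ⁻¹' B') ({ω | ε < |X ω - Y ω|} ×ˢ univ)
  rw [measureReal_prod_prod] at h2 h3
  simp only [probReal_univ, one_mul, mul_one] at h2 h3
  linarith

lemma dist_lt_of {x x' y y' ε ε' : ℝ} (h : |x - y| ≤ ε) (h' : |x' - y'| ≤ ε) (hε : ε < ε') :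
    dist (x, x') (y, y') < ε' := by
  rw [Prod.dist_eq, Real.dist_eq, Real.dist_eq]
  exact (max_le h h').trans_lt hε

section
variable {Ω : Type*} [MeasurableSpace Ω] {P : Measure Ω} [IsProbabilityMeasure P]
    {X Y : ℤ → Ω → ℝ}

lemma prod_bdry {X Y : Ω → ℝ} (hX : Measurable X) (hY : Measurable Y) {ε δ : ℝ} (hε : 0 < ε)
    (hδ : P.real {ω | ε < |X ω - Y ω|} ≤ δ) {A : Set (ℝ × ℝ)} (hA : MeasurableSet A) :
    ((P.map Y).prod (P.map Y)).real (bdry (2 * ε) A) ≤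
      ((P.map X).prod (P.map X)).real (bdry (3 * ε) A) + 2 * δ := by
  refine prod_transfer hX hY hδ (measurableSet_bdry _ hA) (measurableSet_bdry _ hA) ?_
  intro x x' y y' h h' hb
  obtain ⟨r, hr, hne⟩ := mem_bdry_iff.1 hb
  have hd := dist_lt_of h h' (show ε < 3 * ε by linarith)
  have hd1 := dist_lt_of h h' (show ε < ε + ε / 2 by linarith)
  rw [mem_bdry_iff]
  by_cases hc : ((x, x') ∈ A ↔ (y, y') ∈ A)
  · refine ⟨r, ?_, by tauto⟩
    have hle : dist (x, x') (y, y') ≤ ε := by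
      rw [Prod.dist_eq, Real.dist_eq, Real.dist_eq]; exact max_le h h'
    have := dist_triangle (x, x') (y, y') r
    linarith
  · exact ⟨_, hd, hc⟩

lemma prod_level {X Y : Ω → ℝ} (hX : Measurable X) (hY : Measurable Y) {ε δ : ℝ} (hε : 0 < ε)
    (hδ : P.real {ω | ε < |X ω - Y ω|} ≤ δ) {A : Set (ℝ × ℝ)} (hA : MeasurableSet A) :
    |((P.map Y).prod (P.map Y)).real A - ((P.map X).prod (P.map X)).real A| ≤
      ((P.map X).prod (P.map X)).real (bdry (2 * ε) A) + 2 * δ := by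
  have := Measure.isProbabilityMeasure_map (μ := P) hX.aemeasurable
  have := Measure.isProbabilityMeasure_map (μ := P) hY.aemeasurable
  have hb := measurableSet_bdry (2 * ε) hA
  have key : ∀ B : Set (ℝ × ℝ), MeasurableSet B → (∀ q r, (q ∈ A ↔ r ∈ A) → (q ∈ B ↔ r ∈ B)) →
      ((P.map Y).prod (P.map Y)).real B ≤ ((P.map X).prod (P.map X)).real B +
        ((P.map X).prod (P.map X)).real (bdry (2 * ε) A) + 2 * δ := by
    intro B hB hBA
    have h1 := prod_transfer hX hY hδ hB (hB.union hb) (by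
      intro x x' y y' h h' hy
      by_cases hc : ((x, x') ∈ A ↔ (y, y') ∈ A)
      · exact Or.inl ((hBA _ _ hc).2 hy)
      · exact Or.inr (mem_bdry_iff.2 ⟨_, dist_lt_of h h' (by linarith), hc⟩))
    have h2 := measureReal_union_le (μ := (P.map X).prod (P.map X)) B (bdry (2 * ε) A)
    linarith
  have k1 := key A hA (fun _ _ h => h)
  have k2 := key Aᶜ hA.compl (fun _ _ h => not_congr h)
  rw [probReal_compl_eq_one_sub hA, probReal_compl_eq_one_sub hA] at k2
  rw [abs_le]
  constructor <;> linarith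

/-- The event that `(X_i, X_j)` lies in `A`. -/
def evt (X : ℤ → Ω → ℝ) (A : Set (ℝ × ℝ)) (i j : ℤ) : Set Ω := {ω | (X i ω, X j ω) ∈ A}

lemma measurableSet_evt (hX : ∀ i, Measurable (X i)) {A : Set (ℝ × ℝ)} (hA : MeasurableSet A)
    (i j : ℤ) : MeasurableSet (evt X A i j) := ((hX i).prodMk (hX j)) hA

lemma symmDiff_evt (hX : ∀ i, Measurable (X i)) (hY : ∀ i, Measurable (Y i))
    (hs : IsPairStationary P X Y) {ε δ : ℝ} (hε : 0 < ε)
    (hδ : P.real {ω | ε < |X 0 ω - Y 0 ω|} ≤ δ) (A : Set (ℝ × ℝ)) (i j : ℤ) :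
    P.real (symmDiff (evt X A i j) (evt Y A i j)) ≤ 2 * δ + P.real (evt Y (bdry (2 * ε) A) i j) := by
  have hδi : ∀ i, P.real {ω | ε < |X i ω - Y i ω|} ≤ δ := fun i => by
    have hm : MeasurableSet {q : ℝ × ℝ | ε < |q.1 - q.2|} :=
      measurableSet_lt measurable_const (by fun_prop)
    have h := congrArg (fun ν => ν.real {q : ℝ × ℝ | ε < |q.1 - q.2|}) (stat_pair hX hY hs i)
    beta_reduce at h
    rw [map_measureReal_apply ((hX _).prodMk (hY _)) hm,
      map_measureReal_apply ((hX _).prodMk (hY _)) hm] at h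
    exact h.le.trans hδ
  have hsub : symmDiff (evt X A i j) (evt Y A i j) ⊆ ({ω | ε < |X i ω - Y i ω|} ∪
      {ω | ε < |X j ω - Y j ω|}) ∪ evt Y (bdry (2 * ε) A) i j := by
    intro ω hω
    by_cases h1 : |X i ω - Y i ω| ≤ ε
    · by_cases h2 : |X j ω - Y j ω| ≤ ε
      · refine Or.inr (mem_bdry_iff.2 ⟨(X i ω, X j ω), ?_, ?_⟩)
        · rw [dist_comm]; exact dist_lt_of h1 h2 (by linarith)
        · rw [Set.mem_symmDiff] at hω
          simp only [evt, Set.mem_ofPred_eq] at hω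
          tauto
      · exact Or.inl (Or.inr (not_le.1 h2))
    · exact Or.inl (Or.inl (not_le.1 h1))
  have h1 := measureReal_mono (μ := P) hsub
  have h2 := measureReal_union_le (μ := P) ({ω | ε < |X i ω - Y i ω|} ∪
      {ω | ε < |X j ω - Y j ω|}) (evt Y (bdry (2 * ε) A) i j)
  have h3 := measureReal_union_le (μ := P) {ω | ε < |X i ω - Y i ω|} {ω | ε < |X j ω - Y j ω|}
  linarith [hδi i, hδi j]

end

lemma cov_bound {Ω : Type*} [MeasurableSpace Ω] {P : Measure Ω} [IsProbabilityMeasure P]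
    {X Z : ℤ → Ω → ℝ} (hX : ∀ i, Measurable (X i)) (hZ : ∀ i, Measurable (Z i))
    (hs : IsPairStationary P X Z) (l : ℕ) {f : (Fin (2 * l + 1) → ℝ) → ℝ} (hf : Measurable f)
    {β : ℕ → ℝ} (hβ : IsBetaBound P Z β) (s : Fin 4 → ℤ)
    (hsep : ∀ a b, a ≠ b → 3 * (l : ℤ) ≤ |s a - s b|)
    (A : Set (ℝ × ℝ)) (hA : MeasurableSet A) {ε δ L : ℝ} (hε : 0 < ε)
    (hδ : P.real {ω | ε < |X 0 ω - approxY Z l f 0 ω|} ≤ δ)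
    (hL : ∀ ε > 0, ((P.map (X 0)).prod (P.map (X 0))).real (bdry ε A) ≤ L * ε) :
    |P.real (evt X A (s 0) (s 1)) - ((P.map (X 0)).prod (P.map (X 0))).real A|
        ≤ 12 * δ + 16 * β l + 10 * (L * ε) ∧
    |P.real (evt X A (s 2) (s 3)) - ((P.map (X 0)).prod (P.map (X 0))).real A|
        ≤ 12 * δ + 16 * β l + 10 * (L * ε) ∧
    |P.real (evt X A (s 0) (s 1) ∩ evt X A (s 2) (s 3)) -
        ((P.map (X 0)).prod (P.map (X 0))).real A ^ 2| ≤ 12 * δ + 16 * β l + 10 * (L * ε) := by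
  have hYm := measurable_approxY hZ l hf
  have hst := stat_approx hX hZ hs l hf
  set Y := approxY Z l f with hYdef
  have := Measure.isProbabilityMeasure_map (μ := P) (hX 0).aemeasurable
  have := Measure.isProbabilityMeasure_map (μ := P) (hYm 0).aemeasurable
  have hδ0 : 0 ≤ δ := measureReal_nonneg.trans hδ
  have hL0 : 0 ≤ L * ε := measureReal_nonneg.trans (hL ε hε)
  have hb1 := prod_bdry (hX 0) (hYm 0) hε hδ hA
  have hb2 := hL (3 * ε) (by linarith)
  have hlev := prod_level (hX 0) (hYm 0) hε hδ hA
  have hb3 := hL (2 * ε) (by linarith)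
  have hpair : ∀ i j : ℤ, 3 * (l : ℤ) ≤ |i - j| →
      P.real (symmDiff (evt X A i j) (evt Y A i j)) ≤ 4 * δ + 4 * β l + 3 * (L * ε) ∧
      |P.real (evt Y A i j) - ((P.map (Y 0)).prod (P.map (Y 0))).real A| ≤ 4 * β l := by
    intro i j hij
    have h1 := symmDiff_evt hX hYm hst hε hδ A i j
    have h2 := abs_le.1 (pair_close hX hZ hs l hf hβ i j hij _ (measurableSet_bdry (2 * ε) hA))
    have h3 := pair_close hX hZ hs l hf hβ i j hij _ hA
    refine ⟨?_, h3⟩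
    have h4 : P.real (evt Y (bdry (2 * ε) A) i j) -
      ((P.map (Y 0)).prod (P.map (Y 0))).real (bdry (2 * ε) A) ≤ 4 * β l := h2.2
    linarith
  have hβ0 : 0 ≤ β l := by
    have := (abs_nonneg _).trans (hpair _ _ (hsep 0 1 (by decide))).2
    linarith
  have hmX := measurableSet_evt hX hA
  have hmY := measurableSet_evt hYm hA
  have hsd : ∀ S T : Set Ω, MeasurableSet S → MeasurableSet T →
      |P.real S - P.real T| ≤ P.real (symmDiff S T) := fun S T hS hT =>
    abs_measureReal_sub_le_measureReal_symmDiff hS.nullMeasurableSet hT.nullMeasurableSet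
  have hone : ∀ i j : ℤ, 3 * (l : ℤ) ≤ |i - j| →
      |P.real (evt X A i j) - ((P.map (X 0)).prod (P.map (X 0))).real A|
        ≤ 12 * δ + 16 * β l + 10 * (L * ε) := by
    intro i j hij
    have h1 := abs_le.1 (hsd _ _ (hmX i j) (hmY i j))
    have h2 := hpair i j hij
    have h3 := abs_le.1 h2.2
    have h4 := abs_le.1 hlev
    rw [abs_le]
    constructor <;> linarith [h2.1, h1.1, h1.2, h3.1, h3.2, h4.1, h4.2]
  refine ⟨hone _ _ (hsep 0 1 (by decide)), hone _ _ (hsep 2 3 (by decide)), ?_⟩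
  have h1 := abs_le.1 (hsd _ _ ((hmX (s 0) (s 1)).inter (hmX (s 2) (s 3)))
    ((hmY (s 0) (s 1)).inter (hmY (s 2) (s 3))))
  have hsub : symmDiff (evt X A (s 0) (s 1) ∩ evt X A (s 2) (s 3))
      (evt Y A (s 0) (s 1) ∩ evt Y A (s 2) (s 3)) ⊆
      symmDiff (evt X A (s 0) (s 1)) (evt Y A (s 0) (s 1)) ∪
      symmDiff (evt X A (s 2) (s 3)) (evt Y A (s 2) (s 3)) := by
    intro ω
    simp only [Set.mem_symmDiff, mem_union, mem_inter_iff]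
    tauto
  have h2 := measureReal_mono (μ := P) hsub
  have h3 := measureReal_union_le (μ := P)
    (symmDiff (evt X A (s 0) (s 1)) (evt Y A (s 0) (s 1)))
    (symmDiff (evt X A (s 2) (s 3)) (evt Y A (s 2) (s 3)))
  have h4 := (hpair _ _ (hsep 0 1 (by decide))).1
  have h5 := (hpair _ _ (hsep 2 3 (by decide))).1
  have h6 : |P.real (evt Y A (s 0) (s 1) ∩ evt Y A (s 2) (s 3)) -
      ((P.map (Y 0)).prod (P.map (Y 0))).real A ^ 2| ≤ 8 * β l :=
    quad_close hX hZ hs l hf hβ s hsep A hA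
  have h7 : |((P.map (Y 0)).prod (P.map (Y 0))).real A ^ 2 -
      ((P.map (X 0)).prod (P.map (X 0))).real A ^ 2| ≤ 2 * (2 * (L * ε) + 2 * δ) := by
    set a := ((P.map (Y 0)).prod (P.map (Y 0))).real A
    set b := ((P.map (X 0)).prod (P.map (X 0))).real A
    have ha : a ≤ 1 := measureReal_le_one
    have hb : b ≤ 1 := measureReal_le_one
    have ha0 : 0 ≤ a := measureReal_nonneg
    have hb0 : 0 ≤ b := measureReal_nonneg
    rw [sq_sub_sq, abs_mul, abs_of_nonneg (by linarith)]
    exact mul_le_mul (by linarith) (by linarith) (abs_nonneg _) (by norm_num)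
  have h6 := abs_le.1 h6
  have h7 := abs_le.1 h7
  rw [abs_le]
  constructor <;> linarith [h1.1, h1.2, h6.1, h6.2, h7.1, h7.2]

/-- Summable covariance bounds, uniform in `t` near the quantile. -/
lemma exists_cov_bound {Ω : Type*} [MeasurableSpace Ω] {P : Measure Ω} [IsProbabilityMeasure P]
    {X Z : ℤ → Ω → ℝ} (hX : ∀ i, Measurable (X i)) (hZ : ∀ i, Measurable (Z i)) {p : ℝ}
    {g : ℝ → ℝ → ℝ} (hg : Measurable fun q : ℝ × ℝ => g q.1 q.2)
    (hA1 : Assumption1 P X Z) (hA2 : Assumption2 (P.map (X 0)) (hInd g) p) :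
    ∃ (c : ℕ → ℝ) (ρ : ℝ), (∀ l, 0 ≤ c l) ∧ Summable c ∧ 0 < ρ ∧
      ∀ t, |t - Uinv (P.map (X 0)) (hInd g) p| < ρ → ∀ (l : ℕ) (s : Fin 4 → ℤ),
        (∀ a b, a ≠ b → 3 * (l : ℤ) ≤ |s a - s b|) →
        |P.real (evt X (levelSet g t) (s 0) (s 1)) -
          ((P.map (X 0)).prod (P.map (X 0))).real (levelSet g t)| ≤ c l ∧
        |P.real (evt X (levelSet g t) (s 2) (s 3)) -
          ((P.map (X 0)).prod (P.map (X 0))).real (levelSet g t)| ≤ c l ∧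
        |P.real (evt X (levelSet g t) (s 0) (s 1) ∩ evt X (levelSet g t) (s 2) (s 3)) -
          ((P.map (X 0)).prod (P.map (X 0))).real (levelSet g t) ^ 2| ≤ c l := by
  obtain ⟨a, φ, -, -, -, ⟨f, hf, hpned⟩, hO⟩ := hA1.pned
  obtain ⟨β, hβ0, hβ, hsum⟩ := hA1.mixing
  obtain ⟨L, ρ, hρ, hvar⟩ := hA2
  obtain ⟨C, hC0, hC⟩ := hO.exists_pos
  rw [Asymptotics.IsBigOWith] at hC
  obtain ⟨l0, hl0⟩ := eventually_atTop.1 hC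
  have := Measure.isProbabilityMeasure_map (μ := P) (hX 0).aemeasurable
  have hp6 : Summable fun l : ℕ => (l : ℝ) ^ (-6 : ℤ) := by
    have := Real.summable_one_div_nat_pow.2 (show 1 < 6 by norm_num)
    refine this.congr fun l => ?_
    rw [zpow_neg, one_div]; norm_cast
  have hβs : Summable β := by
    refine (summable_nat_add_iff 1).1 (Summable.of_nonneg_of_le (fun k => hβ0 _) (fun k => ?_)
      ((summable_nat_add_iff 1).2 hsum))
    have := hβ0 (k + 1)
    push_cast
    nlinarith [(Nat.cast_nonneg k : (0 : ℝ) ≤ k)]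
  refine ⟨fun l => (if l < l0 + 1 then 1 else 0) +
    (12 * (C * (l : ℝ) ^ (-6 : ℤ)) + 16 * β l + 10 * (max L 0 * (l : ℝ) ^ (-6 : ℤ))), ρ, ?_, ?_, hρ, ?_⟩
  · intro l
    have := hβ0 l
    have : (0 : ℝ) ≤ if l < l0 + 1 then 1 else 0 := by split_ifs <;> norm_num
    positivity
  · refine Summable.add ?_ ?_
    · refine summable_of_hasFiniteSupport ((Set.finite_lt_nat (l0 + 1)).subset ?_)
      intro l hl
      by_contra h
      simp only [Set.mem_ofPred_eq] at h
      simp at hl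
      omega
    · exact ((((hp6.mul_left C).mul_left 12).add (hβs.mul_left 16))).add
        ((hp6.mul_left (max L 0)).mul_left 10)
  · intro t ht l s hsep
    by_cases hl : l < l0 + 1
    · have hpos : 0 ≤ 12 * (C * (l : ℝ) ^ (-6 : ℤ)) + 16 * β l
          + 10 * (max L 0 * (l : ℝ) ^ (-6 : ℤ)) := by
        have := hβ0 l
        positivity
      have h01 : ∀ x y : ℝ, 0 ≤ x → x ≤ 1 → 0 ≤ y → y ≤ 1 → |x - y| ≤
          (if l < l0 + 1 then 1 else 0) + (12 * (C * (l : ℝ) ^ (-6 : ℤ)) + 16 * β l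
          + 10 * (max L 0 * (l : ℝ) ^ (-6 : ℤ))) := by
        intro x y _ _ _ _
        rw [if_pos hl, abs_le]
        constructor <;> linarith
      refine ⟨h01 _ _ measureReal_nonneg measureReal_le_one measureReal_nonneg measureReal_le_one,
        h01 _ _ measureReal_nonneg measureReal_le_one measureReal_nonneg measureReal_le_one,
        h01 _ _ measureReal_nonneg measureReal_le_one (by positivity)
          (pow_le_one₀ measureReal_nonneg measureReal_le_one)⟩
    · simp only [if_neg hl, zero_add]
      have hlpos : (0 : ℝ) < l := by
        have : 0 < l := by omega
        exact_mod_cast this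
      have hε : (0 : ℝ) < (l : ℝ) ^ (-6 : ℤ) := by positivity
      refine cov_bound hX hZ hA1.stationary l (hf l) hβ s hsep _ (measurableSet_levelSet hg t) hε
        ?_ (fun ε hε => variation_bdry _ g hg L t (hvar t ht) ε hε)
      have h1 := hpned l _ hε
      have h2 := hl0 l (by omega)
      rw [Real.norm_eq_abs, Real.norm_eq_abs, abs_of_pos hε] at h2
      refine le_trans ?_ ((h1.trans (le_abs_self _)).trans h2)
      simp [approxY, measureReal_def]

end PartCWrap

section PartDWrap

/-- The V-statistic companion of `Ustat`. -/
def Vst {Ω : Type*} (X : ℤ → Ω → ℝ) (g : ℝ → ℝ → ℝ) (n : ℕ) (t : ℝ) (ω : Ω) : ℝ :=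
  (n : ℝ)⁻¹ ^ 2 * ∑ i ∈ Finset.Icc (1 : ℤ) (n : ℤ), ∑ j ∈ Finset.Icc (1 : ℤ) (n : ℤ),
        hInd g (X i ω) (X j ω) t

lemma Udist_eq (μ : Measure ℝ) [IsProbabilityMeasure μ] {g : ℝ → ℝ → ℝ}
    (hg : Measurable fun q : ℝ × ℝ => g q.1 q.2) (t : ℝ) :
    Udist μ (hInd g) t = (μ.prod μ).real (levelSet g t) := by
  have hm := measurableSet_levelSet hg t
  have he : (fun q : ℝ × ℝ => hInd g q.1 q.2 t) = (levelSet g t).indicator 1 := by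
    funext q
    simp only [hInd, indicator, levelSet, Pi.one_apply, Set.mem_ofPred_eq]
    congr
  rw [← integral_indicator_one hm, ← he]
  unfold Udist
  rw [integral_prod]
  rw [he]
  exact (integrable_const (1 : ℝ)).indicator hm

lemma sum_gap {c : ℕ → ℝ} (hc : ∀ l, 0 ≤ c l) (hs : Summable c) (n : ℕ) (x : ℤ) :
    ∑ y ∈ Finset.Icc (1 : ℤ) n, c ((x - y).natAbs / 3) ≤ 6 * ∑' l, c l := by
  -- split according to sign and residue of the difference
  let F : ℤ → ℕ × (Bool × Fin 3) := fun y =>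
    ((x - y).natAbs / 3, decide (x ≤ y), ⟨(x - y).natAbs % 3, Nat.mod_lt _ (by norm_num)⟩)
  have hF : Function.Injective F := by
    intro y y' h
    simp only [F, Prod.mk.injEq, Fin.mk.injEq, decide_eq_decide] at h
    omega
  have h1 : ∑ y ∈ Finset.Icc (1 : ℤ) n, c ((x - y).natAbs / 3) =
      ∑ q ∈ (Finset.Icc (1 : ℤ) n).image F, c q.1 := by
    rw [Finset.sum_image hF.injOn]
  rw [h1]
  have hsub : (Finset.Icc (1 : ℤ) n).image F ⊆
      (((Finset.Icc (1 : ℤ) n).image F).image Prod.fst) ×ˢ (Finset.univ : Finset (Bool × Fin 3)) := by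
    intro q hq
    simp only [Finset.mem_product, Finset.mem_univ, and_true]
    exact Finset.mem_image_of_mem _ hq
  refine (Finset.sum_le_sum_of_subset_of_nonneg hsub fun q _ _ => hc _).trans ?_
  rw [Finset.sum_product]
  simp only [Finset.sum_const, Finset.card_univ, Fintype.card_prod, Fintype.card_bool,
    Fintype.card_fin, nsmul_eq_mul]
  rw [← Finset.mul_sum]
  norm_num
  exact hs.sum_le_tsum _ fun _ _ => hc _

/-- Bound of the covariance of a quadruple by a sum over pairs. -/
lemma quad_gap {c : ℕ → ℝ} (hc : ∀ l, 0 ≤ c l) (i j k m : ℤ) :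
    ∃ l : ℕ, (∀ a b : Fin 4, a ≠ b → 3 * (l : ℤ) ≤ |(![i, j, k, m] : Fin 4 → ℤ) a - (![i, j, k, m] : Fin 4 → ℤ) b|) ∧
      c l ≤ c ((i - j).natAbs / 3) + c ((i - k).natAbs / 3) + c ((i - m).natAbs / 3) +
        c ((j - k).natAbs / 3) + c ((j - m).natAbs / 3) + c ((k - m).natAbs / 3) := by
  let S : Finset ℕ := {(i - j).natAbs / 3, (i - k).natAbs / 3, (i - m).natAbs / 3,
    (j - k).natAbs / 3, (j - m).natAbs / 3, (k - m).natAbs / 3}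
  have hne : S.Nonempty := ⟨_, Finset.mem_insert_self _ _⟩
  refine ⟨S.min' hne, ?_, ?_⟩
  · have h : ∀ x ∈ S, S.min' hne ≤ x := fun x hx => S.min'_le x hx
    generalize S.min' hne = l at h
    simp only [S, Finset.mem_insert, Finset.mem_singleton, forall_eq_or_imp, forall_eq] at h
    intro a b hab
    fin_cases a <;> fin_cases b <;> simp at hab ⊢ <;>
      (rw [Int.abs_eq_natAbs]; omega)
  · have h := S.min'_mem hne
    generalize S.min' hne = l at h
    simp only [S, Finset.mem_insert, Finset.mem_singleton] at h
    have h1 := hc ((i - j).natAbs / 3)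
    have h2 := hc ((i - k).natAbs / 3)
    have h3 := hc ((i - m).natAbs / 3)
    have h4 := hc ((j - k).natAbs / 3)
    have h5 := hc ((j - m).natAbs / 3)
    have h6 := hc ((k - m).natAbs / 3)
    rcases h with h | h | h | h | h | h <;> rw [h] <;> linarith

lemma sum_quad {c : ℕ → ℝ} (hc : ∀ l, 0 ≤ c l) (hs : Summable c) (n : ℕ) :
    ∑ i ∈ Finset.Icc (1 : ℤ) n, ∑ j ∈ Finset.Icc (1 : ℤ) n, ∑ k ∈ Finset.Icc (1 : ℤ) n,
      ∑ m ∈ Finset.Icc (1 : ℤ) n,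
      (c ((i - j).natAbs / 3) + c ((i - k).natAbs / 3) + c ((i - m).natAbs / 3) +
        c ((j - k).natAbs / 3) + c ((j - m).natAbs / 3) + c ((k - m).natAbs / 3)) ≤
      36 * (n : ℝ) ^ 3 * ∑' l, c l := by
  have hcard : ((Finset.Icc (1 : ℤ) n).card : ℝ) = n := by simp
  set A := Finset.Icc (1 : ℤ) n
  have hD : ∑ x ∈ A, ∑ y ∈ A, c ((x - y).natAbs / 3) ≤ n * (6 * ∑' l, c l) := by
    refine (Finset.sum_le_sum fun x _ => sum_gap hc hs n x).trans ?_
    rw [Finset.sum_const, nsmul_eq_mul, hcard]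
  have hn : (0 : ℝ) ≤ n := Nat.cast_nonneg n
  simp only [Finset.sum_add_distrib, Finset.sum_const, nsmul_eq_mul, hcard, ← Finset.mul_sum]
  have := mul_le_mul_of_nonneg_left hD (by positivity : 0 ≤ (n : ℝ) * n)
  nlinarith [this]

variable {Ω : Type*} [MeasurableSpace Ω] {P : Measure Ω} [IsProbabilityMeasure P]

lemma integral_quad {X : ℤ → Ω → ℝ} (hX : ∀ i, Measurable (X i)) {g : ℝ → ℝ → ℝ}
    (hg : Measurable fun q : ℝ × ℝ => g q.1 q.2) (t : ℝ) (n : ℕ) (hn : 1 ≤ n) (U : ℝ) :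
    ∫ ω, (Vst X g n t ω - U) ^ 2 ∂P = (n : ℝ)⁻¹ ^ 4 *
      ∑ i ∈ Finset.Icc (1 : ℤ) n, ∑ j ∈ Finset.Icc (1 : ℤ) n, ∑ k ∈ Finset.Icc (1 : ℤ) n,
      ∑ m ∈ Finset.Icc (1 : ℤ) n,
      (P.real (evt X (levelSet g t) i j ∩ evt X (levelSet g t) k m)
        - U * P.real (evt X (levelSet g t) i j) - U * P.real (evt X (levelSet g t) k m) + U ^ 2) := by
  have hm := measurableSet_levelSet hg t
  have hn0 : (n : ℝ) ≠ 0 := by positivity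
  have hcard : ((Finset.Icc (1 : ℤ) n).card : ℝ) = n := by simp
  have he : ∀ i j, MeasurableSet (evt X (levelSet g t) i j) := fun i j => measurableSet_evt hX hm i j
  have hI : ∀ i j ω, hInd g (X i ω) (X j ω) t =
      (evt X (levelSet g t) i j).indicator (1 : Ω → ℝ) ω := fun i j ω => by
    simp only [hInd, indicator, evt, levelSet, Pi.one_apply, Set.mem_ofPred_eq]
    congr
  have hV : ∀ ω, Vst X g n t ω - U = (n : ℝ)⁻¹ ^ 2 * ∑ i ∈ Finset.Icc (1 : ℤ) n,
      ∑ j ∈ Finset.Icc (1 : ℤ) n, ((evt X (levelSet g t) i j).indicator (1 : Ω → ℝ) ω - U) := by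
    intro ω
    unfold Vst
    simp only [hI, Finset.sum_sub_distrib, Finset.sum_const, nsmul_eq_mul, hcard]
    field_simp
  have hint : ∀ i j k m, Integrable (fun ω => ((evt X (levelSet g t) i j).indicator (1 : Ω → ℝ) ω - U)
      * ((evt X (levelSet g t) k m).indicator (1 : Ω → ℝ) ω - U)) P := by
    intro i j k m
    have hf : ∀ i j, Integrable (fun ω => (evt X (levelSet g t) i j).indicator (1 : Ω → ℝ) ω) P :=
      fun i j => (integrable_const (1 : ℝ)).indicator (he i j)
    have hff : Integrable (fun ω => (evt X (levelSet g t) i j ∩ evt X (levelSet g t) k m).indicator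
      (1 : Ω → ℝ) ω) P := (integrable_const (1 : ℝ)).indicator ((he i j).inter (he k m))
    refine (((hff.sub ((hf i j).const_mul U)).sub ((hf k m).const_mul U)).add
      (integrable_const (U ^ 2))).congr (ae_of_all _ fun ω => ?_)
    simp only [Pi.add_apply, Pi.sub_apply, Set.inter_indicator_one, Pi.mul_apply]
    ring
  have hval : ∀ i j k m, ∫ ω, ((evt X (levelSet g t) i j).indicator (1 : Ω → ℝ) ω - U)
      * ((evt X (levelSet g t) k m).indicator (1 : Ω → ℝ) ω - U) ∂P =
      P.real (evt X (levelSet g t) i j ∩ evt X (levelSet g t) k m)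
        - U * P.real (evt X (levelSet g t) i j) - U * P.real (evt X (levelSet g t) k m) + U ^ 2 := by
    intro i j k m
    have hf : ∀ i j, Integrable (fun ω => (evt X (levelSet g t) i j).indicator (1 : Ω → ℝ) ω) P :=
      fun i j => (integrable_const (1 : ℝ)).indicator (he i j)
    have hff : Integrable (fun ω => (evt X (levelSet g t) i j ∩ evt X (levelSet g t) k m).indicator
      (1 : Ω → ℝ) ω) P := (integrable_const (1 : ℝ)).indicator ((he i j).inter (he k m))
    have : ∀ ω, ((evt X (levelSet g t) i j).indicator (1 : Ω → ℝ) ω - U)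
      * ((evt X (levelSet g t) k m).indicator (1 : Ω → ℝ) ω - U) =
      (evt X (levelSet g t) i j ∩ evt X (levelSet g t) k m).indicator (1 : Ω → ℝ) ω
      - U * (evt X (levelSet g t) i j).indicator (1 : Ω → ℝ) ω
      - U * (evt X (levelSet g t) k m).indicator (1 : Ω → ℝ) ω + U ^ 2 := by
      intro ω
      simp only [Set.inter_indicator_one, Pi.mul_apply]
      ring
    simp only [this]
    rw [integral_add, integral_sub, integral_sub, integral_const_mul, integral_const_mul,
      integral_indicator_one ((he i j).inter (he k m)), integral_indicator_one (he i j),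
      integral_indicator_one (he k m)]
    · simp
    · exact hff
    · exact (hf i j).const_mul U
    · exact hff.sub ((hf i j).const_mul U)
    · exact (hf k m).const_mul U
    · exact (hff.sub ((hf i j).const_mul U)).sub ((hf k m).const_mul U)
    · exact integrable_const _
  have hsq : ∀ ω, (Vst X g n t ω - U) ^ 2 = (n : ℝ)⁻¹ ^ 4 *
      ∑ i ∈ Finset.Icc (1 : ℤ) n, ∑ j ∈ Finset.Icc (1 : ℤ) n, ∑ k ∈ Finset.Icc (1 : ℤ) n,
      ∑ m ∈ Finset.Icc (1 : ℤ) n, ((evt X (levelSet g t) i j).indicator (1 : Ω → ℝ) ω - U)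
      * ((evt X (levelSet g t) k m).indicator (1 : Ω → ℝ) ω - U) := by
    intro ω
    rw [hV, mul_pow, ← pow_mul, sq (∑ i ∈ _, _)]
    congr 1
    simp only [Finset.sum_mul]
    simp only [Finset.mul_sum]
  simp only [hsq]
  rw [integral_const_mul]
  congr 1
  rw [integral_finsetSum _ fun i _ => integrable_finsetSum _ fun j _ =>
    integrable_finsetSum _ fun k _ => integrable_finsetSum _ fun m _ => hint i j k m]
  refine Finset.sum_congr rfl fun i _ => ?_
  rw [integral_finsetSum _ fun j _ =>
    integrable_finsetSum _ fun k _ => integrable_finsetSum _ fun m _ => hint i j k m]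
  refine Finset.sum_congr rfl fun j _ => ?_
  rw [integral_finsetSum _ fun k _ => integrable_finsetSum _ fun m _ => hint i j k m]
  refine Finset.sum_congr rfl fun k _ => ?_
  rw [integral_finsetSum _ fun m _ => hint i j k m]
  exact Finset.sum_congr rfl fun m _ => hval i j k m

lemma Vst_bounds {Ω : Type*} (X : ℤ → Ω → ℝ) (g : ℝ → ℝ → ℝ) (n : ℕ) (hn : 1 ≤ n) (t : ℝ) (ω : Ω) :
    0 ≤ Vst X g n t ω ∧ Vst X g n t ω ≤ 1 := by
  have hn0 : (0 : ℝ) < n := by positivity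
  have hcard : ((Finset.Icc (1 : ℤ) n).card : ℝ) = n := by simp
  unfold Vst
  constructor
  · exact mul_nonneg (by positivity)
      (Finset.sum_nonneg fun i _ => Finset.sum_nonneg fun j _ => hInd_nonneg _ _ _ _)
  · have : ∑ i ∈ Finset.Icc (1 : ℤ) (n : ℤ), ∑ j ∈ Finset.Icc (1 : ℤ) (n : ℤ),
        hInd g (X i ω) (X j ω) t ≤ n * n := by
      refine (Finset.sum_le_sum fun i _ => Finset.sum_le_sum fun j _ => hInd_le_one _ _ _ _).trans ?_
      simp only [Finset.sum_const, nsmul_eq_mul, hcard, mul_one, le_refl]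
    rw [inv_pow, inv_mul_le_iff₀ (by positivity)]
    nlinarith

lemma measurable_Vst {X : ℤ → Ω → ℝ} (hX : ∀ i, Measurable (X i)) {g : ℝ → ℝ → ℝ}
    (hg : Measurable fun q : ℝ × ℝ => g q.1 q.2) (t : ℝ) (n : ℕ) :
    Measurable (Vst X g n t) := by
  unfold Vst
  refine Measurable.const_mul (Finset.measurable_sum _ fun i _ =>
    Finset.measurable_sum _ fun j _ => ?_) _
  unfold hInd
  exact Measurable.ite (measurableSet_evt hX (measurableSet_levelSet hg t) i j)
    measurable_const measurable_const

lemma exists_var_bound {X Z : ℤ → Ω → ℝ} (hX : ∀ i, Measurable (X i)) (hZ : ∀ i, Measurable (Z i))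
    {p : ℝ} {g : ℝ → ℝ → ℝ} (hg : Measurable fun q : ℝ × ℝ => g q.1 q.2)
    (hA1 : Assumption1 P X Z) (hA2 : Assumption2 (P.map (X 0)) (hInd g) p) :
    ∃ C ρ : ℝ, 0 ≤ C ∧ 0 < ρ ∧ ∀ t, |t - Uinv (P.map (X 0)) (hInd g) p| < ρ → ∀ n : ℕ, 1 ≤ n →
      ∀ τ : ℝ, 0 < τ →
      P.real {ω | τ ≤ |Vst X g n t ω - Udist (P.map (X 0)) (hInd g) t|} ≤ C / (n * τ ^ 2) := by
  obtain ⟨c, ρ, hc, hs, hρ, hcov⟩ := exists_cov_bound hX hZ hg hA1 hA2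
  have := Measure.isProbabilityMeasure_map (μ := P) (hX 0).aemeasurable
  have hT : 0 ≤ ∑' l, c l := tsum_nonneg hc
  refine ⟨108 * ∑' l, c l, ρ, by positivity, hρ, fun t ht n hn τ hτ => ?_⟩
  have hn0 : (0 : ℝ) < n := by positivity
  rw [Udist_eq _ hg]
  set U := ((P.map (X 0)).prod (P.map (X 0))).real (levelSet g t) with hU
  have hU0 : 0 ≤ U := measureReal_nonneg
  have hU1 : U ≤ 1 := measureReal_le_one
  have hint : ∫ ω, (Vst X g n t ω - U) ^ 2 ∂P ≤ (108 * ∑' l, c l) / n := by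
    rw [integral_quad hX hg t n hn U]
    have hterm : ∀ i j k m : ℤ,
        P.real (evt X (levelSet g t) i j ∩ evt X (levelSet g t) k m)
        - U * P.real (evt X (levelSet g t) i j) - U * P.real (evt X (levelSet g t) k m) + U ^ 2 ≤
        3 * (c ((i - j).natAbs / 3) + c ((i - k).natAbs / 3) + c ((i - m).natAbs / 3) +
        c ((j - k).natAbs / 3) + c ((j - m).natAbs / 3) + c ((k - m).natAbs / 3)) := by
      intro i j k m
      obtain ⟨l, hl, hcl⟩ := quad_gap hc i j k m
      obtain ⟨h1, h2, h3⟩ := hcov t ht l _ hl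
      simp only [Matrix.cons_val] at h1 h2 h3
      rw [abs_le] at h1 h2 h3
      have := hc l
      nlinarith [mul_le_mul_of_nonneg_left h1.1 hU0, mul_le_mul_of_nonneg_left h2.1 hU0,
        mul_nonneg (sub_nonneg.2 hU1) this]
    have := (Finset.sum_le_sum fun i (_ : i ∈ Finset.Icc (1 : ℤ) n) =>
      Finset.sum_le_sum fun j (_ : j ∈ Finset.Icc (1 : ℤ) n) =>
      Finset.sum_le_sum fun k (_ : k ∈ Finset.Icc (1 : ℤ) n) =>
      Finset.sum_le_sum fun m (_ : m ∈ Finset.Icc (1 : ℤ) n) => hterm i j k m)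
    simp only [← Finset.mul_sum] at this
    have h2 := mul_le_mul_of_nonneg_left (sum_quad hc hs n) (by norm_num : (0 : ℝ) ≤ 3)
    have h3 := mul_le_mul_of_nonneg_left (this.trans h2) (by positivity : 0 ≤ (n : ℝ)⁻¹ ^ 4)
    refine h3.trans (le_of_eq ?_)
    field_simp
    ring
  have hmeas := measurable_Vst hX hg t n
  have hi : Integrable (fun ω => (Vst X g n t ω - U) ^ 2) P := by
    refine Integrable.of_bound (by fun_prop) 1 (ae_of_all _ fun ω => ?_)
    obtain ⟨h0, h1⟩ := Vst_bounds X g n hn t ω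
    rw [Real.norm_eq_abs, abs_of_nonneg (by positivity)]
    rw [sq_le_one_iff_abs_le_one, abs_le]
    constructor <;> linarith
  have hch := mul_meas_ge_le_integral_of_nonneg (μ := P) (ae_of_all _ fun ω => sq_nonneg
    (Vst X g n t ω - U)) hi (τ ^ 2)
  have hset : {ω | τ ≤ |Vst X g n t ω - U|} ⊆ {ω | τ ^ 2 ≤ (Vst X g n t ω - U) ^ 2} := by
    intro ω hω
    simp only [Set.mem_ofPred_eq] at hω ⊢
    rw [← sq_abs (Vst X g n t ω - U)]
    exact pow_le_pow_left₀ hτ.le hω 2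
  have hle := measureReal_mono (μ := P) hset
  have h5 := mul_le_mul_of_nonneg_left hle (sq_nonneg τ)
  have h6 := (h5.trans hch).trans hint
  rw [le_div_iff₀ (by positivity)]
  rw [le_div_iff₀ hn0] at h6
  linarith

end PartDWrap

section PartEWrap

section PartE

lemma Vst_mono {Ω : Type*} (X : ℤ → Ω → ℝ) (g : ℝ → ℝ → ℝ) (n : ℕ) (ω : Ω) :
    Monotone fun t => Vst X g n t ω := by
  intro s t hst
  exact mul_le_mul_of_nonneg_left (Finset.sum_le_sum fun i _ => Finset.sum_le_sum fun j _ =>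
    hInd_mono g _ _ hst) (by positivity)

lemma Ustat_mono {Ω : Type*} (X : ℤ → Ω → ℝ) (g : ℝ → ℝ → ℝ) (n : ℕ) (hn : 2 ≤ n) (ω : Ω) :
    Monotone fun t => Ustat X (hInd g) n t ω := by
  intro s t hst
  have hn2 : (2 : ℝ) ≤ n := by exact_mod_cast hn
  exact mul_le_mul_of_nonneg_left (Finset.sum_le_sum fun i _ => Finset.sum_le_sum fun j _ =>
    hInd_mono g _ _ hst) (div_nonneg (by norm_num) (mul_nonneg (by linarith) (by linarith)))

lemma sum_square_split (n : ℕ) (F : ℤ → ℤ → ℝ) (hF : ∀ i j, F i j = F j i) :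
    ∑ i ∈ Finset.Icc (1 : ℤ) n, ∑ j ∈ Finset.Icc (1 : ℤ) n, F i j =
      2 * ∑ i ∈ Finset.Icc (1 : ℤ) n, ∑ j ∈ Finset.Ioc i (n : ℤ), F i j +
        ∑ i ∈ Finset.Icc (1 : ℤ) n, F i i := by
  set A := Finset.Icc (1 : ℤ) n
  have h1 : ∀ i ∈ A, ∑ j ∈ Finset.Ioc i (n : ℤ), F i j = ∑ j ∈ A, if i < j then F i j else 0 := by
    intro i hi
    rw [← Finset.sum_filter]
    refine Finset.sum_congr ?_ fun _ _ => rfl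
    ext j
    simp only [A, Finset.mem_Icc] at hi
    simp only [A, Finset.mem_filter, Finset.mem_Icc, Finset.mem_Ioc]
    omega
  have h2 : ∑ i ∈ A, ∑ j ∈ A, (if i < j then F i j else 0) =
      ∑ i ∈ A, ∑ j ∈ A, (if j < i then F i j else 0) := by
    rw [Finset.sum_comm]
    refine Finset.sum_congr rfl fun i _ => Finset.sum_congr rfl fun j _ => ?_
    rw [hF]
  have h3 : ∑ i ∈ A, F i i = ∑ i ∈ A, ∑ j ∈ A, (if i = j then F i j else 0) := by
    refine Finset.sum_congr rfl fun i hi => ?_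
    rw [Finset.sum_ite_eq, if_pos hi]
  rw [Finset.sum_congr rfl h1, two_mul]
  nth_rewrite 2 [h2]
  rw [h3, ← Finset.sum_add_distrib, ← Finset.sum_add_distrib]
  refine Finset.sum_congr rfl fun i _ => ?_
  rw [← Finset.sum_add_distrib, ← Finset.sum_add_distrib]
  refine Finset.sum_congr rfl fun j _ => ?_
  rcases lt_trichotomy i j with h | h | h
  · simp [h, h.ne, h.not_gt]
  · simp [h]
  · simp [h, h.ne', h.not_gt]

lemma Vst_Ustat {Ω : Type*} (X : ℤ → Ω → ℝ) {g : ℝ → ℝ → ℝ} (hg : ∀ x y, g x y = g y x)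
    (n : ℕ) (hn : 2 ≤ n) (t : ℝ) (ω : Ω) :
    |Vst X g n t ω - Ustat X (hInd g) n t ω| ≤ 1 / n := by
  have hn2 : (2 : ℝ) ≤ n := by exact_mod_cast hn
  have hcard : ((Finset.Icc (1 : ℤ) n).card : ℝ) = n := by simp
  have hsp := sum_square_split n (fun i j => hInd g (X i ω) (X j ω) t) (fun i j => by
    simp only [hInd, hg (X i ω)])
  unfold Vst Ustat
  rw [hsp]
  set S := ∑ i ∈ Finset.Icc (1 : ℤ) n, ∑ j ∈ Finset.Ioc i (n : ℤ), hInd g (X i ω) (X j ω) t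
  set D := ∑ i ∈ Finset.Icc (1 : ℤ) n, hInd g (X i ω) (X i ω) t
  have hD0 : 0 ≤ D := Finset.sum_nonneg fun i _ => hInd_nonneg _ _ _ _
  have hDn : D ≤ n := by
    refine (Finset.sum_le_sum fun i _ => hInd_le_one _ _ _ _).trans ?_
    simp
  have hS0 : 0 ≤ S := Finset.sum_nonneg fun i _ => Finset.sum_nonneg fun j _ => hInd_nonneg _ _ _ _
  have hSn : 2 * S ≤ n * (n - 1) := by
    have h1 := sum_square_split n (fun _ _ => 1) (fun _ _ => rfl)
    simp only [Finset.sum_const, nsmul_eq_mul, hcard, mul_one] at h1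
    have h2 : S ≤ ∑ i ∈ Finset.Icc (1 : ℤ) n, ∑ j ∈ Finset.Ioc i (n : ℤ), (1 : ℝ) :=
      Finset.sum_le_sum fun i _ => Finset.sum_le_sum fun j _ => hInd_le_one _ _ _ _
    simp only [Finset.sum_const, nsmul_eq_mul, mul_one] at h2
    linarith
  have hkey : (n : ℝ)⁻¹ ^ 2 * (2 * S + D) - 2 / ((n : ℝ) * ((n : ℝ) - 1)) * S =
      (D - (2 * S) / (n - 1)) / n ^ 2 := by
    have : (n : ℝ) - 1 ≠ 0 := by linarith
    field_simp
    ring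
  have hq0 : 0 ≤ (2 * S) / ((n : ℝ) - 1) := div_nonneg (by linarith) (by linarith)
  have hq1 : (2 * S) / ((n : ℝ) - 1) ≤ n := by rw [div_le_iff₀ (by linarith)]; exact hSn
  rw [hkey, abs_div, abs_of_pos (by positivity : (0 : ℝ) < (n : ℝ) ^ 2),
    div_le_div_iff₀ (by positivity) (by linarith)]
  have : |D - (2 * S) / ((n : ℝ) - 1)| ≤ n := by rw [abs_le]; constructor <;> linarith
  nlinarith

lemma h1hat_abs {Ω : Type*} (X : ℤ → Ω → ℝ) (g : ℝ → ℝ → ℝ) (n : ℕ) (hn : 1 ≤ n) (x t : ℝ)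
    (ω : Ω) : |h1hat X g n x t ω| ≤ 1 := by
  have hn0 : (0 : ℝ) < n := by positivity
  have hV := Vst_bounds (Ω := Ω) X g n hn t ω
  unfold Vst at hV
  unfold h1hat
  have h0 : 0 ≤ (n : ℝ)⁻¹ * ∑ i ∈ Finset.Icc (1 : ℤ) (n : ℤ), hInd g x (X i ω) t :=
    mul_nonneg (by positivity) (Finset.sum_nonneg fun i _ => hInd_nonneg _ _ _ _)
  have h1 : (n : ℝ)⁻¹ * ∑ i ∈ Finset.Icc (1 : ℤ) (n : ℤ), hInd g x (X i ω) t ≤ 1 := by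
    rw [inv_mul_le_iff₀ hn0]
    refine (Finset.sum_le_sum fun i _ => hInd_le_one _ _ _ _).trans ?_
    simp
  rw [abs_le]
  constructor <;> linarith [hV.1, hV.2]

/-- Total variation of `ĥ₁` over the sample. -/
lemma h1hat_var {Ω : Type*} (X : ℤ → Ω → ℝ) (g : ℝ → ℝ → ℝ) (n : ℕ) (hn : 1 ≤ n) {a b t t' : ℝ}
    (ha : a ≤ t) (hb : t ≤ b) (ha' : a ≤ t') (hb' : t' ≤ b) (ω : Ω) :
    ∑ i ∈ Finset.Icc (1 : ℤ) n, |h1hat X g n (X i ω) t ω - h1hat X g n (X i ω) t' ω| ≤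
      2 * n * (Vst X g n b ω - Vst X g n a ω) := by
  have hn0 : (0 : ℝ) < n := by positivity
  have hcard : ((Finset.Icc (1 : ℤ) n).card : ℝ) = n := by simp
  have hvv : |Vst X g n t ω - Vst X g n t' ω| ≤ Vst X g n b ω - Vst X g n a ω := by
    have h1 := Vst_mono X g n ω ha
    have h2 := Vst_mono X g n ω ha'
    have h3 := Vst_mono X g n ω hb
    have h4 := Vst_mono X g n ω hb'
    simp only at h1 h2 h3 h4
    rw [abs_le]; constructor <;> linarith
  have hhh : ∀ i j, |hInd g (X i ω) (X j ω) t - hInd g (X i ω) (X j ω) t'| ≤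
      hInd g (X i ω) (X j ω) b - hInd g (X i ω) (X j ω) a := by
    intro i j
    have h1 := hInd_mono g (X i ω) (X j ω) ha
    have h2 := hInd_mono g (X i ω) (X j ω) ha'
    have h3 := hInd_mono g (X i ω) (X j ω) hb
    have h4 := hInd_mono g (X i ω) (X j ω) hb'
    rw [abs_le]; constructor <;> linarith
  have hterm : ∀ i ∈ Finset.Icc (1 : ℤ) n, |h1hat X g n (X i ω) t ω - h1hat X g n (X i ω) t' ω| ≤
      (n : ℝ)⁻¹ * ∑ j ∈ Finset.Icc (1 : ℤ) n,
        (hInd g (X i ω) (X j ω) b - hInd g (X i ω) (X j ω) a)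
        + (Vst X g n b ω - Vst X g n a ω) := by
    intro i _
    have he : h1hat X g n (X i ω) t ω - h1hat X g n (X i ω) t' ω =
        (n : ℝ)⁻¹ * ∑ j ∈ Finset.Icc (1 : ℤ) n,
          (hInd g (X i ω) (X j ω) t - hInd g (X i ω) (X j ω) t')
        - (Vst X g n t ω - Vst X g n t' ω) := by
      unfold h1hat Vst
      rw [Finset.sum_sub_distrib]
      ring
    rw [he]
    refine (abs_sub _ _).trans (add_le_add ?_ hvv)
    rw [abs_mul, abs_of_nonneg (by positivity)]
    exact mul_le_mul_of_nonneg_left ((Finset.abs_sum_le_sum_abs _ _).trans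
      (Finset.sum_le_sum fun j _ => hhh i j)) (by positivity)
  refine (Finset.sum_le_sum hterm).trans (le_of_eq ?_)
  rw [Finset.sum_add_distrib, Finset.sum_const, nsmul_eq_mul, hcard, ← Finset.mul_sum]
  simp only [Finset.sum_sub_distrib]
  unfold Vst
  field_simp
  ring

lemma rhohat_diff {Ω : Type*} (X : ℤ → Ω → ℝ) (g : ℝ → ℝ → ℝ) (n r : ℕ) (hn : 1 ≤ n)
    {a b t t' : ℝ}
    (ha : a ≤ t) (hb : t ≤ b) (ha' : a ≤ t') (hb' : t' ≤ b) (ω : Ω) :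
    |rhohat X g n r t ω - rhohat X g n r t' ω| ≤ 4 * (Vst X g n b ω - Vst X g n a ω) := by
  have hn0 : (0 : ℝ) < n := by positivity
  have hvar := h1hat_var X g n hn ha hb ha' hb' ω
  unfold rhohat
  rw [← mul_sub, ← Finset.sum_sub_distrib, abs_mul, abs_of_pos (inv_pos.2 hn0),
    inv_mul_le_iff₀ hn0]
  set D : ℤ → ℝ := fun i => |h1hat X g n (X i ω) t ω - h1hat X g n (X i ω) t' ω| with hD
  have hD0 : ∀ i, 0 ≤ D i := fun i => abs_nonneg _
  have hterm : ∀ i, |h1hat X g n (X i ω) t ω * h1hat X g n (X (i + (r : ℤ)) ω) t ω -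
      h1hat X g n (X i ω) t' ω * h1hat X g n (X (i + (r : ℤ)) ω) t' ω| ≤ D i + D (i + r) := by
    intro i
    have h1 := h1hat_abs X g n hn (X (i + (r : ℤ)) ω) t ω
    have h2 := h1hat_abs X g n hn (X i ω) t' ω
    have : h1hat X g n (X i ω) t ω * h1hat X g n (X (i + (r : ℤ)) ω) t ω -
      h1hat X g n (X i ω) t' ω * h1hat X g n (X (i + (r : ℤ)) ω) t' ω =
      (h1hat X g n (X i ω) t ω - h1hat X g n (X i ω) t' ω) * h1hat X g n (X (i + (r : ℤ)) ω) t ω +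
      h1hat X g n (X i ω) t' ω * (h1hat X g n (X (i + (r : ℤ)) ω) t ω
        - h1hat X g n (X (i + (r : ℤ)) ω) t' ω) := by ring
    rw [this]
    refine (abs_add_le _ _).trans (add_le_add ?_ ?_)
    · rw [abs_mul]
      exact mul_le_of_le_one_right (abs_nonneg _) h1
    · rw [abs_mul]
      exact mul_le_of_le_one_left (abs_nonneg _) h2
  refine (Finset.abs_sum_le_sum_abs _ _).trans ((Finset.sum_le_sum fun i _ => hterm i).trans ?_)
  rw [Finset.sum_add_distrib]
  have hs1 : ∑ i ∈ Finset.Icc (1 : ℤ) ((n : ℤ) - r), D i ≤ ∑ i ∈ Finset.Icc (1 : ℤ) n, D i :=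
    Finset.sum_le_sum_of_subset_of_nonneg (Finset.Icc_subset_Icc le_rfl (by omega))
      fun i _ _ => hD0 i
  have hs2 : ∑ i ∈ Finset.Icc (1 : ℤ) ((n : ℤ) - r), D (i + r) ≤ ∑ i ∈ Finset.Icc (1 : ℤ) n, D i := by
    rw [← Finset.sum_image (f := D) (g := fun i : ℤ => i + r) (fun x _ y _ h => by simpa using h)]
    refine Finset.sum_le_sum_of_subset_of_nonneg ?_ fun i _ _ => hD0 i
    intro x hx
    simp only [Finset.mem_image, Finset.mem_Icc] at hx ⊢
    omega
  linarith

lemma W_sum {W : ℝ → ℝ} {b : ℕ → ℝ} (h5 : Assumption5 W b) :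
    ∃ C : ℝ, 0 < C ∧ ∀ n : ℕ, 1 ≤ b n →
      ∑ r ∈ Finset.Icc (-(n : ℤ) + 1) ((n : ℤ) - 1), |W ((r.natAbs : ℝ) / b n)| ≤ C * b n := by
  obtain ⟨Wb, hanti, hint, hdom⟩ := h5.dominated
  have hWb0 : ∀ x, 0 ≤ x → 0 ≤ Wb x := fun x hx => (abs_nonneg _).trans (hdom x hx)
  set I := ∫ x in Ioi (0 : ℝ), Wb x with hI
  have hI0 : 0 ≤ I := setIntegral_nonneg measurableSet_Ioi fun x hx => hWb0 x (le_of_lt hx)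
  refine ⟨1 + 2 * I, by positivity, fun n hb => ?_⟩
  have hb0 : 0 < b n := by linarith
  have hpos : ∑ k ∈ Finset.range n, Wb (((k : ℕ) + 1 : ℕ) / b n) ≤ b n * I := by
    have h1 := AntitoneOn.sum_le_integral (f := fun x => Wb (x / b n)) (x₀ := 0) (a := n) (by
      intro x hx y hy hxy
      refine hanti ?_ ?_ (by gcongr)
      · exact div_nonneg hx.1 hb0.le
      · exact div_nonneg hy.1 hb0.le)
    simp only [zero_add] at h1
    refine h1.trans ?_
    rw [intervalIntegral.integral_comp_div _ hb0.ne', smul_eq_mul, zero_div]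
    refine mul_le_mul_of_nonneg_left ?_ hb0.le
    rw [intervalIntegral.integral_of_le (by positivity)]
    refine setIntegral_mono_set (hint.mono_set Ioi_subset_Ici_self) ?_ ?_
    · exact (ae_restrict_iff' measurableSet_Ioi).2 (ae_of_all _ fun x hx => hWb0 x (le_of_lt hx))
    · exact Ioc_subset_Ioi_self.eventuallyLE
  -- reduce the two-sided sum to one-sided sums
  have hsub : Finset.Icc (-(n : ℤ) + 1) ((n : ℤ) - 1) ⊆ ({0} : Finset ℤ) ∪
      ((Finset.range n).image (fun k : ℕ => ((k : ℤ) + 1)) ∪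
        (Finset.range n).image (fun k : ℕ => (-((k : ℤ) + 1)))) := by
    intro r hr
    simp only [Finset.mem_union, Finset.mem_singleton, Finset.mem_image, Finset.mem_range,
      Finset.mem_Icc] at hr ⊢
    rcases lt_trichotomy r 0 with h | h | h
    · exact Or.inr (Or.inr ⟨(-r - 1).toNat, by omega, by omega⟩)
    · exact Or.inl h
    · exact Or.inr (Or.inl ⟨(r - 1).toNat, by omega, by omega⟩)
  have hnn : ∀ r : ℤ, 0 ≤ |W ((r.natAbs : ℝ) / b n)| := fun r => abs_nonneg _
  have hun : ∀ s t : Finset ℤ, ∑ r ∈ s ∪ t, |W ((r.natAbs : ℝ) / b n)| ≤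
      ∑ r ∈ s, |W ((r.natAbs : ℝ) / b n)| + ∑ r ∈ t, |W ((r.natAbs : ℝ) / b n)| := fun s t => by
    rw [← Finset.sum_union_inter]
    exact le_add_of_nonneg_right (Finset.sum_nonneg fun r _ => hnn r)
  have h0 : |W (0 / b n)| ≤ 1 := by
    rw [zero_div]
    have := h5.range 0 le_rfl
    rw [abs_le]; constructor <;> linarith [this.1, this.2]
  have hs : ∀ k : ℕ, |W (((k + 1 : ℕ) : ℝ) / b n)| ≤ Wb (((k : ℕ) + 1 : ℕ) / b n) := fun k =>
    hdom _ (by positivity)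
  have hp : ∑ r ∈ (Finset.range n).image (fun k : ℕ => ((k : ℤ) + 1)),
      |W ((r.natAbs : ℝ) / b n)| ≤ b n * I := by
    rw [Finset.sum_image (fun x _ y _ h => by simpa using h)]
    refine le_trans (Finset.sum_le_sum fun k _ => ?_) hpos
    have : ((k : ℤ) + 1).natAbs = k + 1 := by omega
    rw [this]
    exact hs k
  have hm : ∑ r ∈ (Finset.range n).image (fun k : ℕ => (-((k : ℤ) + 1))),
      |W ((r.natAbs : ℝ) / b n)| ≤ b n * I := by
    rw [Finset.sum_image (fun x _ y _ h => by simpa using h)]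
    refine le_trans (Finset.sum_le_sum fun k _ => ?_) hpos
    have : (-((k : ℤ) + 1)).natAbs = k + 1 := by omega
    rw [this]
    exact hs k
  refine (Finset.sum_le_sum_of_subset_of_nonneg hsub fun r _ _ => hnn r).trans ?_
  refine (hun _ _).trans ?_
  have hu2 := hun ((Finset.range n).image (fun k : ℕ => ((k : ℤ) + 1)))
    ((Finset.range n).image (fun k : ℕ => (-((k : ℤ) + 1))))
  rw [Finset.sum_singleton]
  simp only [Int.natAbs_zero, Nat.cast_zero]
  nlinarith

lemma U_expand {μ : Measure ℝ} {h : ℝ → ℝ → ℝ → ℝ} {p : ℝ} {u : ℝ → ℝ}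
    (hA3 : Assumption3 μ h p u) :
    ∃ δ > 0, ∀ t, |t - Uinv μ h p| < δ →
      |Udist μ h t - p - u (Uinv μ h p) * (t - Uinv μ h p)| ≤
        u (Uinv μ h p) / 2 * |t - Uinv μ h p| := by
  obtain ⟨-, hu, ho⟩ := hA3
  have := ho.def (half_pos hu)
  obtain ⟨δ, hδ, hb⟩ := Metric.eventually_nhds_iff.1 this
  refine ⟨min δ 1, lt_min hδ one_pos, fun t ht => ?_⟩
  have h1 := hb (y := t) (by rw [Real.dist_eq]; exact ht.trans_le (min_le_left _ _))
  rw [Real.norm_eq_abs, Real.norm_eq_abs, abs_of_nonneg (Real.rpow_nonneg (abs_nonneg _) _)] at h1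
  refine h1.trans (mul_le_mul_of_nonneg_left ?_ (half_pos hu).le)
  have hle : |t - Uinv μ h p| ≤ 1 := (ht.trans_le (min_le_right _ _)).le
  calc |t - Uinv μ h p| ^ ((3 : ℝ) / 2) ≤ |t - Uinv μ h p| ^ (1 : ℝ) :=
        Real.rpow_le_rpow_of_exponent_ge' (abs_nonneg _) hle (by norm_num) (by norm_num)
    _ = _ := Real.rpow_one _

end PartE

end PartEWrap

section PartF

/-- Deterministic core: if the V-statistics at `t₀ ± s` are close to their targets, the weighted
sum is small. -/
lemma core_bound {Ω : Type*} (X : ℤ → Ω → ℝ) {g : ℝ → ℝ → ℝ} (hg_symm : ∀ x y, g x y = g y x)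
    (p t0 u0 s : ℝ) (hu0 : 0 < u0) (hs : 0 < s) (Up Um : ℝ)
    (hUp : |Up - p - u0 * s| ≤ u0 / 2 * s) (hUm : |Um - p + u0 * s| ≤ u0 / 2 * s)
    (n : ℕ) (hn : 2 ≤ n) (hns : 1 / (n : ℝ) < u0 * s / 4) (ω : Ω)
    (hVp : |Vst X g n (t0 + s) ω - Up| < u0 * s / 4)
    (hVm : |Vst X g n (t0 - s) ω - Um| < u0 * s / 4)
    (w : ℤ → ℝ) (K : ℝ) (hw : ∑ r ∈ Finset.Icc (-(n : ℤ) + 1) ((n : ℤ) - 1), |w r| ≤ K) :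
    |∑ r ∈ Finset.Icc (-(n : ℤ) + 1) ((n : ℤ) - 1), w r *
      (rhohat X g n r.natAbs (UinvEmp X (hInd g) n p ω) ω - rhohat X g n r.natAbs t0 ω)| ≤
      K * (14 * (u0 * s)) := by
  have hus : 0 < u0 * s := mul_pos hu0 hs
  have e1 := Vst_Ustat X hg_symm n hn (t0 + s) ω
  have e2 := Vst_Ustat X hg_symm n hn (t0 - s) ω
  rw [abs_le] at hUp hUm e1 e2
  rw [abs_lt] at hVp hVm
  have hmem : p ≤ Ustat X (hInd g) n (t0 + s) ω := by linarith [hVp.1, hUp.1, e1.2]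
  have hnot : Ustat X (hInd g) n (t0 - s) ω < p := by linarith [hVm.2, hUm.2, e2.1]
  have hlb : ∀ t ∈ {t | p ≤ Ustat X (hInd g) n t ω}, t0 - s ≤ t := by
    intro t ht
    by_contra hlt
    have h1 := Ustat_mono X g n hn ω (not_le.1 hlt).le
    simp only at h1
    have h2 : p ≤ Ustat X (hInd g) n t ω := ht
    linarith
  have htn1 : UinvEmp X (hInd g) n p ω ≤ t0 + s := csInf_le ⟨t0 - s, hlb⟩ hmem
  have htn2 : t0 - s ≤ UinvEmp X (hInd g) n p ω := le_csInf ⟨_, hmem⟩ hlb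
  have hdiff : ∀ r : ℕ, |rhohat X g n r (UinvEmp X (hInd g) n p ω) ω - rhohat X g n r t0 ω| ≤
      14 * (u0 * s) := by
    intro r
    refine (rhohat_diff X g n r (by omega) htn2 htn1 (by linarith) (by linarith) ω).trans ?_
    linarith [hVp.2, hUp.2, hVm.1, hUm.1]
  refine (Finset.abs_sum_le_sum_abs _ _).trans ?_
  calc _ ≤ ∑ r ∈ Finset.Icc (-(n : ℤ) + 1) ((n : ℤ) - 1), |w r| * (14 * (u0 * s)) := by
        refine Finset.sum_le_sum fun r _ => ?_
        rw [abs_mul]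
        exact mul_le_mul_of_nonneg_left (hdiff _) (abs_nonneg _)
    _ ≤ _ := by
        rw [← Finset.sum_mul]
        exact mul_le_mul_of_nonneg_right hw (by positivity)

end PartF

/-- (Lemma B.1.) Under Assumptions 1, 2, 3 and 5, with the kernel
`h(x,y,t) = 1{g(x,y) ≤ t}`, writing `t₀ = U⁻¹(p)` and `t_n = U_n⁻¹(p)`, the weighted sum of
differences of sample autocovariances of `ĥ₁` evaluated at `t_n` and at `t₀` tends to `0`
in probability. -/
theorem hac_sum_difference_tendsto_zero
    {Ω : Type*} [MeasurableSpace Ω] (P : Measure Ω) [IsProbabilityMeasure P]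
    (X Z : ℤ → Ω → ℝ) (hX : ∀ i, Measurable (X i)) (hZ : ∀ i, Measurable (Z i))
    (p : ℝ) (hp : p ∈ Set.Ioo (0 : ℝ) 1)
    (g : ℝ → ℝ → ℝ) (hg_symm : ∀ x y, g x y = g y x)
    (hg_meas : Measurable fun q : ℝ × ℝ => g q.1 q.2)
    (u : ℝ → ℝ) (W : ℝ → ℝ) (b : ℕ → ℝ)
    (hA1 : Assumption1 P X Z)
    (hA2 : Assumption2 (P.map (X 0)) (hInd g) p)
    (hA3 : Assumption3 (P.map (X 0)) (hInd g) p u)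
    (hA5 : Assumption5 W b) :
    TendstoInMeasure P
      (fun (n : ℕ) ω =>
        ∑ r ∈ Finset.Icc (-(n : ℤ) + 1) ((n : ℤ) - 1),
          W ((r.natAbs : ℝ) / b n) *
            (rhohat X g n r.natAbs (UinvEmp X (hInd g) n p ω) ω
              - rhohat X g n r.natAbs (Uinv (P.map (X 0)) (hInd g) p) ω))
      atTop (fun _ => (0 : ℝ)) := by
  obtain ⟨C, ρ, hC, hρ, hvar⟩ := exists_var_bound hX hZ hg_meas hA1 hA2
  obtain ⟨δ, hδ, hU⟩ := U_expand hA3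
  obtain ⟨K, hK, hW⟩ := W_sum hA5
  have hu := hA3.2.1
  set t0 := Uinv (P.map (X 0)) (hInd g) p with ht0
  set u0 := u t0 with hu0
  set Ud := Udist (P.map (X 0)) (hInd g) with hUd
  rw [tendstoInMeasure_iff_measureReal_dist]
  intro ε hε
  set η : ℝ := ε / (28 * K * u0) with hη
  have hη0 : 0 < η := by positivity
  have hηε : K * (14 * (u0 * η)) < ε := by
    have : K * (14 * (u0 * η)) = ε / 2 := by
      rw [hη]; field_simp; ring
    linarith
  have hsq : Tendsto (fun n : ℕ => (b n / Real.sqrt n) ^ 2) atTop (𝓝 0) := by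
    simpa using hA5.b_sqrt.pow 2
  have hbound : Tendsto (fun n : ℕ => (2 * C * 16 / (u0 * η) ^ 2) * (b n / Real.sqrt n) ^ 2)
      atTop (𝓝 0) := by
    simpa using hsq.const_mul (2 * C * 16 / (u0 * η) ^ 2)
  have hs0 : Tendsto (fun n => η / b n) atTop (𝓝 0) := hA5.b_top.const_div_atTop η
  refine tendsto_of_tendsto_of_tendsto_of_le_of_le' tendsto_const_nhds hbound
    (Eventually.of_forall fun n => measureReal_nonneg) ?_
  filter_upwards [hA5.b_top.eventually_ge_atTop 1, eventually_ge_atTop 2,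
    hs0.eventually (gt_mem_nhds (lt_min hρ hδ)),
    hA5.b_sqrt.eventually (gt_mem_nhds (show (0 : ℝ) < u0 * η / 4 by positivity))]
    with n hb hn hsn hbn
  have hb0 : 0 < b n := by linarith
  have hn2 : (2 : ℝ) ≤ n := by exact_mod_cast hn
  have hn0 : (0 : ℝ) < n := by linarith
  set s := η / b n with hs
  have hspos : 0 < s := by positivity
  have hsqn : Real.sqrt n ≤ n := by
    rw [Real.sqrt_le_left (by linarith)]
    nlinarith
  have hsqpos : 0 < Real.sqrt n := Real.sqrt_pos.2 hn0
  have hns : 1 / (n : ℝ) < u0 * s / 4 := by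
    have h1 : b n / n < u0 * η / 4 :=
      (div_le_div_of_nonneg_left hb0.le hsqpos hsqn).trans_lt hbn
    have h2 : 1 / (n : ℝ) = (b n / n) / b n := by field_simp
    have h3 : u0 * s / 4 = (u0 * η / 4) / b n := by rw [hs]; ring
    rw [h2, h3]
    exact div_lt_div_of_pos_right h1 hb0
  have hap : |t0 + s - t0| = s := by rw [add_sub_cancel_left, abs_of_pos hspos]
  have ham : |t0 - s - t0| = s := by rw [sub_sub_cancel_left, abs_neg, abs_of_pos hspos]
  have hUp := hU (t0 + s) (by rw [hap]; exact hsn.trans_le (min_le_right _ _))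
  have hUm := hU (t0 - s) (by rw [ham]; exact hsn.trans_le (min_le_right _ _))
  rw [hap, add_sub_cancel_left] at hUp
  rw [ham, sub_sub_cancel_left, mul_neg, sub_neg_eq_add] at hUm
  have hτ : 0 < u0 * s / 4 := by positivity
  have hPp := hvar (t0 + s) (by rw [hap]; exact hsn.trans_le (min_le_left _ _)) n (by omega) _ hτ
  have hPm := hvar (t0 - s) (by rw [ham]; exact hsn.trans_le (min_le_left _ _)) n (by omega) _ hτ
  have hsub : {ω | ε ≤ dist (∑ r ∈ Finset.Icc (-(n : ℤ) + 1) ((n : ℤ) - 1),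
          W ((r.natAbs : ℝ) / b n) *
            (rhohat X g n r.natAbs (UinvEmp X (hInd g) n p ω) ω
              - rhohat X g n r.natAbs t0 ω)) 0} ⊆
      {ω | u0 * s / 4 ≤ |Vst X g n (t0 + s) ω - Ud (t0 + s)|} ∪
      {ω | u0 * s / 4 ≤ |Vst X g n (t0 - s) ω - Ud (t0 - s)|} := by
    intro ω hω
    by_contra hcon
    simp only [Set.mem_union, Set.mem_ofPred_eq, not_or, not_le] at hcon hω
    have h := core_bound X hg_symm p t0 u0 s hu hspos _ _ hUp hUm n hn hns ω hcon.1 hcon.2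
      (fun r => W ((r.natAbs : ℝ) / b n)) (K * b n) (hW n hb)
    rw [Real.dist_eq, sub_zero] at hω
    have h2 : K * b n * (14 * (u0 * s)) = K * (14 * (u0 * η)) := by
      rw [hs]; field_simp
    linarith
  refine (measureReal_mono hsub).trans ((measureReal_union_le _ _).trans
    ((add_le_add hPp hPm).trans (le_of_eq ?_)))
  rw [div_pow (b n), Real.sq_sqrt hn0.le, hs]
  field_simp
  ring

end UQuantile
end
end
end

section
/- Let F have a Lebesgue density f such that (A) f is cadlag (right-continuous with left limits) on ℝ, (B) sup_{s<t} |(f(t−) − f(s))/(t − s)| < ∞, and (C) the support of f is a connected set or f is symmetric around some point of ℝ. Let X, Y be independent with distribution F and let U(t) = P((X+Y)/2 ≤ t). Then U is differentiable in a neighborhood of its median m (the point with U(m) = 1/2), its derivative u satisfies u(m) > 0, and |U(t) − 1/2 − u(m)(t − m)| = o(|t − m|^{3/2}) as t → m; i.e., Assumption 3 (with p = 1/2) holds for the Hodges–Lehmann kernel h(x,y,t) = 1{(x+y)/2 ≤ t}. -/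
open MeasureTheory Filter Set
open scoped ENNReal NNReal Topology

noncomputable section

/-- The U-distribution function of the Hodges–Lehmann kernel:
`U(t) = P((X + Y)/2 ≤ t)` for `X, Y` independent with law `μ`. -/
def hlU (μ : Measure ℝ) (t : ℝ) : ℝ :=
  ((μ.prod μ) {q : ℝ × ℝ | (q.1 + q.2) / 2 ≤ t}).toReal

/-- The median of `(X + Y)/2`. -/
def hlMed (μ : Measure ℝ) : ℝ := sInf {t | 1 / 2 ≤ hlU μ t}

open ProbabilityTheory

theorem hl_lip (f fm : ℝ → ℝ) (C : ℝ)
    (hB : ∀ s t : ℝ, s < t → |fm t - f s| ≤ C * (t - s)) :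
    ∀ x y, |f x - f y| ≤ C * |x - y| := by
  have h1 : ∀ s t : ℝ, s < t → |f t - f s| ≤ C * (t - s) := by
    intro s t hst
    have key : ∀ t', t < t' → |f t - f s| ≤ C * (t' - t) + C * (t' - s) := by
      intro t' ht'
      have a := hB t t' ht'
      have b := hB s t' (hst.trans ht')
      have : f t - f s = -(fm t' - f t) + (fm t' - f s) := by ring
      rw [this]
      refine (abs_add_le _ _).trans ?_
      rw [abs_neg]; linarith
    have hc : Tendsto (fun t' => C * (t' - t) + C * (t' - s)) (𝓝[>] t) (𝓝 (C * (t - t) + C * (t - s))) := by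
      apply Tendsto.mono_left _ nhdsWithin_le_nhds
      exact Continuous.tendsto (by fun_prop) t
    have := ge_of_tendsto hc (by
      filter_upwards [self_mem_nhdsWithin] with t' ht' using key t' ht')
    simpa using this
  intro x y
  rcases lt_trichotomy x y with h | h | h
  · rw [abs_sub_comm, abs_sub_comm x y, abs_of_pos (sub_pos.2 h)]; exact h1 x y h
  · simp [h]
  · rw [abs_of_pos (sub_pos.2 h)]; exact h1 y x h

theorem hlU_eq_cdf (μ : Measure ℝ) [IsProbabilityMeasure μ] :
    ∃ ν : Measure ℝ, IsProbabilityMeasure ν ∧ ∀ t, hlU μ t = cdf ν t := by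
  have hm : Measurable (fun q : ℝ × ℝ => (q.1 + q.2) / 2) := by fun_prop
  have : IsProbabilityMeasure ((μ.prod μ).map (fun q : ℝ × ℝ => (q.1 + q.2) / 2)) :=
    Measure.isProbabilityMeasure_map hm.aemeasurable
  refine ⟨_, this, fun t => ?_⟩
  rw [cdf_eq_real, measureReal_def, Measure.map_apply hm measurableSet_Iic]
  rfl

theorem hlU_eq_integral (μ : Measure ℝ) [IsProbabilityMeasure μ] (t : ℝ) :
    hlU μ t = ∫ s, cdf μ (2 * t - s) ∂μ := by
  have hm : Measurable (fun q : ℝ × ℝ => (q.1 + q.2) / 2) := by fun_prop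
  have e0 : hlU μ t =
      ((μ.prod μ) ((fun q : ℝ × ℝ => (q.1 + q.2) / 2) ⁻¹' Iic t)).toReal := rfl
  rw [e0, Measure.prod_apply (hm measurableSet_Iic)]
  rw [← integral_toReal]
  · congr 1
    ext s
    rw [cdf_eq_real, measureReal_def]
    congr 2
    ext y
    simp only [mem_preimage, mem_Iic]
    constructor <;> intro h <;> linarith
  · exact (measurable_measure_prodMk_left (hm measurableSet_Iic)).aemeasurable
  · exact Eventually.of_forall fun s => measure_lt_top _ _

theorem hl_main
    (f : ℝ → ℝ) (hf_nonneg : ∀ x, 0 ≤ f x)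
    (μ : Measure ℝ) [IsProbabilityMeasure μ]
    (hμ : μ = volume.withDensity fun x => ENNReal.ofReal (f x))
    (C : ℝ) (hL : ∀ x y, |f x - f y| ≤ C * |x - y|)
    (hC : IsConnected (closure {x | 0 < f x}) ∨ ∃ c : ℝ, ∀ x, f (c + x) = f (c - x)) :
    ∃ u : ℝ → ℝ,
      (∀ᶠ t in nhds (hlMed μ), HasDerivAt (hlU μ) (u t) t) ∧
      0 < u (hlMed μ) ∧
      (fun t => hlU μ t - 1 / 2 - u (hlMed μ) * (t - hlMed μ))
        =o[nhds (hlMed μ)] fun t => |t - hlMed μ| ^ ((3 : ℝ) / 2) := by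
  have hC0 : 0 ≤ C := by have := (abs_nonneg _).trans (hL 0 1); simpa using this
  have hcont : Continuous f := by
    have : LipschitzWith ⟨C, hC0⟩ f := LipschitzWith.of_dist_le_mul (fun x y => hL x y)
    exact this.continuous
  have hint : Integrable f := by
    refine ⟨hcont.aestronglyMeasurable, ?_⟩
    rw [hasFiniteIntegral_iff_ofReal (Eventually.of_forall hf_nonneg)]
    have := measure_lt_top μ univ
    rw [hμ] at this
    simpa using this
  have hF : ∀ a b, cdf μ b - cdf μ a = ∫ x in a..b, f x := by
    have hF0 : ∀ a, cdf μ a = ∫ x in Iic a, f x := by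
      intro a
      rw [cdf_eq_real, measureReal_def, hμ, withDensity_apply _ measurableSet_Iic,
        ← ofReal_integral_eq_lintegral_ofReal hint.integrableOn (Eventually.of_forall hf_nonneg),
        ENNReal.toReal_ofReal (integral_nonneg hf_nonneg)]
    intro a b
    rw [hF0, hF0, intervalIntegral.integral_Iic_sub_Iic hint.integrableOn hint.integrableOn]
  have hF2 : ∀ a b, |cdf μ b - cdf μ a - (b - a) * f a| ≤ C * (b - a) ^ 2 := by
    intro a b
    have e : cdf μ b - cdf μ a - (b - a) * f a = ∫ x in a..b, (f x - f a) := by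
      rw [intervalIntegral.integral_sub (hcont.intervalIntegrable _ _) (by simp), hF]
      simp
    rw [e]
    have := intervalIntegral.norm_integral_le_of_norm_le_const (a := a) (b := b)
      (f := fun x => f x - f a) (C := C * |b - a|) (by
        intro x hx
        refine (hL x a).trans (mul_le_mul_of_nonneg_left ?_ hC0)
        exact abs_sub_left_of_mem_uIcc (uIoc_subset_uIcc hx))
    refine this.trans (le_of_eq ?_)
    rw [mul_assoc, ← sq, sq_abs]
  have hbd : ∀ x, f x ≤ 1 + C := by
    intro x
    have := hF2 x (x + 1)
    have h1 := cdf_le_one μ (x + 1)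
    have h2 := cdf_nonneg μ x
    have := (abs_le.1 this).1
    ring_nf at this ⊢
    ring_nf at h1
    linarith
  have hif : ∀ t, Integrable (fun s => f (2 * t - s)) μ := by
    intro t
    refine Integrable.of_bound (C := 1 + C) (by fun_prop) (Eventually.of_forall fun s => ?_)
    rw [Real.norm_of_nonneg (hf_nonneg _)]; exact hbd _
  have hiF : ∀ t, Integrable (fun s => cdf μ (2 * t - s)) μ := by
    intro t
    have hm : Measurable (cdf μ) := (monotone_cdf μ).measurable
    refine Integrable.of_bound (C := 1)
      (hm.comp (by fun_prop : Measurable fun s : ℝ => 2 * t - s)).aestronglyMeasurable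
      (Eventually.of_forall fun s => ?_)
    rw [Real.norm_of_nonneg (cdf_nonneg _ _)]; exact cdf_le_one _ _
  set u : ℝ → ℝ := fun t => 2 * ∫ s, f (2 * t - s) ∂μ with hu
  have hquad : ∀ t t', |hlU μ t' - hlU μ t - u t * (t' - t)| ≤ 4 * C * (t' - t) ^ 2 := by
    intro t t'
    have e : hlU μ t' - hlU μ t - u t * (t' - t) =
        ∫ s, (cdf μ (2 * t' - s) - cdf μ (2 * t - s)
          - ((2 * t' - s) - (2 * t - s)) * f (2 * t - s)) ∂μ := by
      have e2 : ∀ s, ((2 * t' - s) - (2 * t - s)) * f (2 * t - s)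
        = (2 * (t' - t)) * f (2 * t - s) := by intro s; ring
      simp only [e2]
      rw [integral_sub (f := fun s => cdf μ (2 * t' - s) - cdf μ (2 * t - s))
        ((hiF t').sub (hiF t)) ((hif t).const_mul _), integral_sub (hiF t') (hiF t),
        integral_const_mul, ← hlU_eq_integral, ← hlU_eq_integral]
      simp only [hu]; ring
    rw [e]
    have := norm_integral_le_of_norm_le_const (μ := μ) (C := 4 * C * (t' - t) ^ 2)
      (f := fun s => (cdf μ (2 * t' - s) - cdf μ (2 * t - s)
          - ((2 * t' - s) - (2 * t - s)) * f (2 * t - s))) (Eventually.of_forall fun s => by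
        refine (hF2 _ _).trans (le_of_eq (by ring)))
    simpa using this
  have hO : ∀ t, (fun t' => hlU μ t' - hlU μ t - u t * (t' - t))
      =O[𝓝 t] fun t' => (t' - t) ^ 2 := by
    intro t
    refine Asymptotics.IsBigO.of_bound (4 * C) (Eventually.of_forall fun t' => ?_)
    rw [Real.norm_eq_abs, Real.norm_eq_abs, abs_of_nonneg (sq_nonneg (t' - t))]
    exact hquad t t'
  have hlittle : ∀ t, (fun t' => hlU μ t' - hlU μ t - u t * (t' - t))
      =o[𝓝 t] fun t' => |t' - t| ^ ((3 : ℝ) / 2) := by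
    intro t
    refine (hO t).trans_isLittleO ?_
    have e : (fun t' : ℝ => (t' - t) ^ 2) =
        fun t' => |t' - t| ^ ((1 : ℝ) / 2) * |t' - t| ^ ((3 : ℝ) / 2) := by
      ext t'
      rw [← Real.rpow_add_of_nonneg (abs_nonneg _) (by norm_num) (by norm_num), ← sq_abs]
      norm_num
    rw [e]
    have h0 : (fun t' : ℝ => |t' - t| ^ ((1 : ℝ) / 2)) =o[𝓝 t] (fun _ => (1 : ℝ)) := by
      rw [Asymptotics.isLittleO_one_iff]
      have : Continuous fun t' : ℝ => |t' - t| ^ ((1 : ℝ) / 2) :=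
        (by fun_prop : Continuous fun t' : ℝ => |t' - t|).rpow_const (by intro x; right; norm_num)
      have := this.tendsto t
      simpa using this
    simpa using h0.mul_isBigO (Asymptotics.isBigO_refl (fun t' : ℝ => |t' - t| ^ ((3 : ℝ) / 2)) (𝓝 t))
  have hder : ∀ t, HasDerivAt (hlU μ) (u t) t := by
    intro t
    rw [hasDerivAt_iff_isLittleO]
    have h2 : (fun t' : ℝ => (t' - t) ^ 2) =o[𝓝 t] fun t' => t' - t :=
      by
      simpa using Asymptotics.isLittleO_pow_sub_sub t (m := 2) (by norm_num)
    refine ((hO t).trans_isLittleO h2).congr_left fun t' => ?_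
    simp [mul_comm]
  obtain ⟨ν, hν, hUν⟩ := hlU_eq_cdf μ
  have hUcont : Continuous (hlU μ) := continuous_iff_continuousAt.2 fun t => (hder t).continuousAt
  have hUmono : Monotone (hlU μ) := by
    intro a b h; rw [hUν, hUν]; exact monotone_cdf ν h
  have hUtop : Tendsto (hlU μ) atTop (𝓝 1) := by
    rw [show hlU μ = cdf ν from funext hUν]; exact tendsto_cdf_atTop ν
  have hUbot : Tendsto (hlU μ) atBot (𝓝 0) := by
    rw [show hlU μ = cdf ν from funext hUν]; exact tendsto_cdf_atBot ν
  set m := hlMed μ with hm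
  obtain ⟨a0, ha0⟩ := (hUbot.eventually (gt_mem_nhds (show (0:ℝ) < 1/2 by norm_num))).exists
  obtain ⟨b0, hb0⟩ := (hUtop.eventually (lt_mem_nhds (show (1/2:ℝ) < 1 by norm_num))).exists
  have hbdd : BddBelow {t | 1 / 2 ≤ hlU μ t} := by
    refine ⟨a0, fun t ht => ?_⟩
    by_contra h
    have := hUmono (not_le.1 h).le
    have ht' : 1 / 2 ≤ hlU μ t := ht
    linarith
  have hmem : 1 / 2 ≤ hlU μ m :=
    (isClosed_le continuous_const hUcont).csInf_mem ⟨b0, hb0.le⟩ hbdd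
  have hmU : hlU μ m = 1 / 2 := by
    refine le_antisymm ?_ hmem
    have hc : Tendsto (hlU μ) (𝓝[<] m) (𝓝 (hlU μ m)) := hUcont.continuousAt.continuousWithinAt
    refine le_of_tendsto hc ?_
    filter_upwards [self_mem_nhdsWithin] with t ht
    by_contra h
    exact absurd (csInf_le hbdd (show t ∈ {t | 1 / 2 ≤ hlU μ t} from (not_le.1 h).le)) (not_le.2 ht)
  have hnull : ∀ V : Set ℝ, IsOpen V → V.Nonempty → (∀ x ∈ V, 0 < f x) → μ V ≠ 0 := by
    intro V hV hne hpos h0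
    rw [hμ, withDensity_apply _ hV.measurableSet, lintegral_eq_zero_iff (by fun_prop)] at h0
    have h1 : ∀ᵐ x ∂(volume.restrict V), False := by
      filter_upwards [h0, ae_restrict_mem hV.measurableSet] with x hx hxV
      have := hpos x hxV
      simp at hx
      linarith
    rw [eventually_false_iff_eq_bot, ae_eq_bot, Measure.restrict_eq_zero] at h1
    exact (hV.measure_pos volume hne).ne' h1
  have hupos : ∀ t a, 0 < f a → 0 < f (2 * t - a) → 0 < u t := by
    intro t a h1 h2
    have : 0 < ∫ s, f (2 * t - s) ∂μ := by
      rw [integral_pos_iff_support_of_nonneg (fun s => hf_nonneg _) (hif t)]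
      have ho : IsOpen ({s | 0 < f s} ∩ {s | 0 < f (2 * t - s)}) :=
        (isOpen_lt continuous_const hcont).inter
          (isOpen_lt continuous_const (hcont.comp (by fun_prop)))
      refine (pos_iff_ne_zero.2 (hnull _ ho ⟨a, h1, h2⟩ fun x hx => hx.1)).trans_le
        (measure_mono ?_)
      intro s hs
      exact ne_of_gt hs.2
    simp only [hu]; linarith
  have hex : ∃ a, 0 < f a := by
    by_contra! h
    have : f = 0 := funext fun x => le_antisymm (h x) (hf_nonneg x)
    have h1 : μ univ = 1 := measure_univ
    rw [hμ, this] at h1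
    simp at h1
  have hmain : 0 < u m := by
    rcases hC with hC | ⟨c, hc⟩
    · by_contra hneg
      have hz : ∀ a, 0 < f a → f (2 * m - a) = 0 := by
        intro a ha
        by_contra h
        exact hneg (hupos m a ha (lt_of_le_of_ne (hf_nonneg _) (Ne.symm h)))
      have hside : (∀ a, 0 < f a → a ≤ m) ∨ (∀ a, 0 < f a → m ≤ a) := by
        by_contra! h
        obtain ⟨⟨b, hb, hmb⟩, ⟨a, ha, ham⟩⟩ := h
        have hIcc : Icc a b ⊆ closure {x | 0 < f x} :=
          hC.isPreconnected.Icc_subset (subset_closure ha) (subset_closure hb)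
        have hW : IsOpen (Ioo a b ∩ {s | 2 * m - s ∈ Ioo a b}) :=
          isOpen_Ioo.inter (isOpen_Ioo.preimage (by fun_prop))
        have hmW : m ∈ Ioo a b ∩ {s | 2 * m - s ∈ Ioo a b} := by
          refine ⟨⟨ham, hmb⟩, ?_, ?_⟩ <;> linarith
        obtain ⟨x, hxW, hx⟩ := mem_closure_iff.1 (hIcc ⟨ham.le, hmb.le⟩) _ hW hmW
        have hopen : IsOpen {s : ℝ | 0 < f (2 * m - s)} :=
          isOpen_lt continuous_const (hcont.comp (by fun_prop))
        obtain ⟨y, hy1, hy2⟩ := mem_closure_iff.1 (hIcc (Ioo_subset_Icc_self hxW.2)) _ hopen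
          (by simpa using hx)
        exact absurd (hz y hy2) (ne_of_gt hy1)
      rcases hside with h | h
      · have h1 : ∀ s, s ≤ m → cdf μ (2 * m - s) = 1 := by
          intro s hs
          have : ∀ b, m ≤ b → cdf μ b = cdf μ m := by
            intro b hb
            have e := hF m b
            rw [intervalIntegral.integral_congr_ae (g := fun _ => (0:ℝ))] at e
            · simp at e; linarith
            · refine Eventually.of_forall fun x hx => ?_
              rw [uIoc_of_le hb] at hx
              by_contra h'
              exact absurd (h x (lt_of_le_of_ne (hf_nonneg _) (Ne.symm h'))) (not_le.2 hx.1)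
          rw [this _ (by linarith)]
          have ht := tendsto_cdf_atTop μ
          refine tendsto_nhds_unique (tendsto_const_nhds.congr' ?_) ht
          filter_upwards [eventually_ge_atTop m] with b hb using (this b hb).symm
        have hae : ∀ᵐ s ∂μ, s ≤ m := by
          rw [hμ, ae_withDensity_iff (by fun_prop)]
          refine Eventually.of_forall fun x hx => h x ?_
          simpa using hx
        have : hlU μ m = 1 := by
          rw [hlU_eq_integral, integral_congr_ae (g := fun _ => (1:ℝ))]
          · simp
          · filter_upwards [hae] with s hs using h1 s hs
        linarith
      · have h1 : ∀ s, m ≤ s → cdf μ (2 * m - s) = 0 := by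
          intro s hs
          have : ∀ b, b ≤ m → cdf μ b = cdf μ m := by
            intro b hb
            have e := hF b m
            rw [intervalIntegral.integral_congr_ae (g := fun _ => (0:ℝ))] at e
            · simp at e; linarith
            · filter_upwards [Measure.ae_ne volume m] with x hxm hx
              rw [uIoc_of_le hb] at hx
              by_contra h'
              exact absurd (h x (lt_of_le_of_ne (hf_nonneg _) (Ne.symm h')))
                (not_le.2 (lt_of_le_of_ne hx.2 hxm))
          rw [this _ (by linarith)]
          have ht := tendsto_cdf_atBot μ
          refine tendsto_nhds_unique (tendsto_const_nhds.congr' ?_) ht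
          filter_upwards [eventually_le_atBot m] with b hb using (this b hb).symm
        have hae : ∀ᵐ s ∂μ, m ≤ s := by
          rw [hμ, ae_withDensity_iff (by fun_prop)]
          refine Eventually.of_forall fun x hx => h x ?_
          simpa using hx
        have : hlU μ m = 0 := by
          rw [hlU_eq_integral, integral_congr_ae (g := fun _ => (0:ℝ))]
          · simp
          · filter_upwards [hae] with s hs using h1 s hs
        linarith
    · have hc' : ∀ x, f (2 * c - x) = f x := by
        intro x
        have := hc (x - c)
        ring_nf at this ⊢
        exact this.symm
      have huc : 0 < u c := by
        obtain ⟨a, ha⟩ := hex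
        exact hupos c a ha (by rw [hc']; exact ha)
      have huv : ∀ t, u t = 2 * ∫ s, f s * f (2 * t - s) := by
        intro t
        simp only [hu]
        rw [hμ, integral_withDensity_eq_integral_toReal_smul (by fun_prop) (by simp)]
        simp [ENNReal.toReal_ofReal, hf_nonneg]
      have husym : ∀ t, u (2 * c - t) = u t := by
        intro t
        rw [huv, huv, ← integral_sub_left_eq_self (fun s => f s * f (2 * t - s)) volume (2 * c)]
        congr 2
        ext s
        rw [hc', ← hc' (2 * t - (2 * c - s))]
        ring_nf
      have hUc : hlU μ c = 1 / 2 := by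
        have hd : ∀ t, HasDerivAt (fun t => hlU μ t + hlU μ (2 * c - t)) 0 t := by
          intro t
          have := (hder t).add ((hder (2 * c - t)).comp_const_sub (2 * c) t)
          rw [husym, add_neg_cancel] at this
          exact this
        have hconst : ∀ t, hlU μ t + hlU μ (2 * c - t) = hlU μ c + hlU μ (2 * c - c) := fun t =>
          is_const_of_deriv_eq_zero (fun t => (hd t).differentiableAt) (fun t => (hd t).deriv) t c
        have hlim : Tendsto (fun t => hlU μ t + hlU μ (2 * c - t)) atTop (𝓝 (1 + 0)) := by
          refine hUtop.add (hUbot.comp ?_)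
          exact tendsto_atBot_add_const_left _ _ tendsto_neg_atTop_atBot
        have := tendsto_nhds_unique (tendsto_const_nhds.congr fun t => (hconst t).symm) hlim
        have e : 2 * c - c = c := by ring
        rw [e] at this
        linarith
      have hmc : m ≤ c := csInf_le hbdd (show (1:ℝ) / 2 ≤ hlU μ c from hUc.ge)
      rcases hmc.eq_or_lt with h | h
      · rw [h]; exact huc
      · exfalso
        have hev : (hlU μ) =ᶠ[𝓝[<] c] fun _ => 1 / 2 := by
          filter_upwards [Ioo_mem_nhdsLT h] with t ht
          have h1 := hUmono ht.1.le
          have h2 := hUmono ht.2.le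
          linarith
        have h1 : HasDerivWithinAt (hlU μ) 0 (Iio c) c :=
          (hasDerivWithinAt_const c (Iio c) (1 / 2 : ℝ)).congr_of_eventuallyEq hev hUc
        have := (uniqueDiffWithinAt_Iio c).eq_deriv _ h1 (hder c).hasDerivWithinAt
        linarith
  refine ⟨u, Eventually.of_forall hder, hmain, ?_⟩
  have := hlittle m
  rw [hmU] at this
  exact this

/-- If `F` has a Lebesgue density `f` which is (A) cadlag, (B) has
uniformly bounded difference quotients `(f(t-) - f(s))/(t - s)`, and (C) has connected
support or is symmetric around some point, then the U-distribution function
`U(t) = P((X+Y)/2 ≤ t)` of the Hodges–Lehmann kernel is differentiable in a neighborhood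
of its median `m`, with derivative `u` satisfying `u(m) > 0` and
`|U(t) - 1/2 - u(m)(t - m)| = o(|t - m|^{3/2})` as `t → m`; i.e. Assumption 3 with
`p = 1/2` holds for the Hodges–Lehmann kernel. -/
theorem hl_smoothness_of_density
    (f : ℝ → ℝ) (hf_nonneg : ∀ x, 0 ≤ f x)
    (μ : Measure ℝ) [IsProbabilityMeasure μ]
    (hμ : μ = volume.withDensity fun x => ENNReal.ofReal (f x))
    (fm : ℝ → ℝ)
    (h_left_limits : ∀ x : ℝ, Tendsto f (nhdsWithin x (Iio x)) (nhds (fm x)))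
    (h_cadlag : ∀ x : ℝ, ContinuousWithinAt f (Ici x) x)
    (hB : ∃ C : ℝ, ∀ s t : ℝ, s < t → |fm t - f s| ≤ C * (t - s))
    (hC : IsConnected (closure {x | 0 < f x}) ∨ ∃ c : ℝ, ∀ x, f (c + x) = f (c - x)) :
    ∃ u : ℝ → ℝ,
      (∀ᶠ t in nhds (hlMed μ), HasDerivAt (hlU μ) (u t) t) ∧
      0 < u (hlMed μ) ∧
      (fun t => hlU μ t - 1 / 2 - u (hlMed μ) * (t - hlMed μ))
        =o[nhds (hlMed μ)] fun t => |t - hlMed μ| ^ ((3 : ℝ) / 2) := by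
  obtain ⟨C, hB⟩ := hB
  exact hl_main f hf_nonneg μ hμ C (hl_lip f fm C hB) hC
end
end

section
/- Let X, Y be independent exponentially distributed random variables with rate 1. Then (X+Y)/2 has distribution function U(t) = 1 − e^{−2t}(1 + 2t) for t ≥ 0 and density u(t) = 4t·e^{−2t}; the median h of (X+Y)/2 (the unique h > 0 with U(h) = 1/2) satisfies e^{2h} = 2(1 + 2h); and with ψ(x) = P((x+Y)/2 ≤ h) − 1/2, the i.i.d. Hodges–Lehmann long-run variance equals σ²_HL = 4·E[ψ(X)²]/u(h)² = (3 − (2h − 1)²)/(2h)². -/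
open MeasureTheory Filter Set Real
open scoped ENNReal NNReal Topology

noncomputable section

/-- The exponential distribution with rate 1 (density `e^{-x}` on `[0, ∞)`). -/
def expMeas : Measure ℝ :=
  volume.withDensity fun x => ENNReal.ofReal (if 0 ≤ x then Real.exp (-x) else 0)

/-- The U-distribution function of the Hodges–Lehmann kernel for Exp(1):
`U(t) = P((X + Y)/2 ≤ t)`. -/
def expHLU (t : ℝ) : ℝ :=
  ((expMeas.prod expMeas) {q : ℝ × ℝ | (q.1 + q.2) / 2 ≤ t}).toReal

def hlG (x : ℝ) : ℝ := if 0 ≤ x then 1 - Real.exp (-x) else 0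

lemma expMeas_eq : expMeas = ProbabilityTheory.expMeasure 1 := by
  unfold expMeas ProbabilityTheory.expMeasure ProbabilityTheory.gammaMeasure
  congr 1
  ext x
  have := ProbabilityTheory.exponentialPDF_eq 1 x
  unfold ProbabilityTheory.exponentialPDF ProbabilityTheory.exponentialPDFReal at this
  unfold ProbabilityTheory.gammaPDF
  rw [this]
  simp

instance expMeas_prob : IsProbabilityMeasure expMeas := by
  rw [expMeas_eq]
  exact ProbabilityTheory.isProbabilityMeasure_expMeasure one_pos

lemma expMeas_Iic (x : ℝ) : (expMeas (Iic x)).toReal = hlG x := by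
  have h := ProbabilityTheory.cdf_expMeasure_eq one_pos x
  rw [← expMeas_eq, ProbabilityTheory.cdf_eq_real] at h
  simpa [hlG, Measure.real] using h

lemma expMeas_slice (x t : ℝ) : (expMeas {y | (x + y) / 2 ≤ t}).toReal = hlG (2 * t - x) := by
  rw [← expMeas_Iic]
  congr 2
  ext y
  simp only [mem_setOf_eq, mem_Iic]
  constructor <;> intro h <;> linarith

lemma integral_expMeas (f : ℝ → ℝ) :
    ∫ x, f x ∂expMeas = ∫ x in Ioi 0, Real.exp (-x) * f x := by
  unfold expMeas
  rw [integral_withDensity_eq_integral_toReal_smul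
    (by apply Measurable.ennreal_ofReal; exact Measurable.ite measurableSet_Ici (by fun_prop) (by fun_prop))
    (by simp)]
  rw [← integral_Ici_eq_integral_Ioi, ← integral_indicator measurableSet_Ici]
  congr 1
  ext x
  by_cases hx : 0 ≤ x
  · simp [hx, Real.exp_nonneg]
  · simp [hx]

lemma expHLU_eq_integral (t : ℝ) : expHLU t = ∫ x, hlG (2 * t - x) ∂expMeas := by
  unfold expHLU
  have hm : MeasurableSet {q : ℝ × ℝ | (q.1 + q.2) / 2 ≤ t} :=
    measurableSet_le (by fun_prop) (by fun_prop)
  rw [Measure.prod_apply hm, ← integral_toReal (measurable_measure_prodMk_left hm).aemeasurable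
    (Eventually.of_forall fun x => measure_lt_top _ _)]
  congr 1
  ext x
  exact expMeas_slice x t

lemma expHLU_nonneg_arg (t : ℝ) (ht : 0 ≤ t) :
    expHLU t = 1 - Real.exp (-2 * t) * (1 + 2 * t) := by
  rw [expHLU_eq_integral, integral_expMeas]
  have h1 : ∫ x in Ioi 0, Real.exp (-x) * hlG (2 * t - x)
      = ∫ x in Ioc 0 (2 * t), (Real.exp (-x) - Real.exp (-2 * t)) := by
    rw [← integral_indicator measurableSet_Ioi, ← integral_indicator measurableSet_Ioc]
    congr 1
    ext x
    by_cases hx : 0 < x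
    · by_cases hx2 : x ≤ 2 * t
      · have : Real.exp (-2 * t) = Real.exp (-x) * Real.exp (-(2 * t - x)) := by
          rw [← Real.exp_add]; ring_nf
        simp only [hlG, indicator, mem_Ioi, mem_Ioc, hx, hx2, sub_nonneg, and_self, if_true]
        rw [this]; ring
      · simp [hlG, hx, hx2]
    · simp [hx]
  rw [h1, ← intervalIntegral.integral_of_le (by linarith),
    intervalIntegral.integral_eq_sub_of_hasDerivAt
      (f := fun x => -Real.exp (-x) - x * Real.exp (-2 * t))
      (fun x _ => by
        have := ((hasDerivAt_neg x).exp.neg).sub ((hasDerivAt_id x).mul_const (Real.exp (-2 * t)))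
        refine this.congr_deriv ?_
        ring)
      (Continuous.intervalIntegrable (by fun_prop) _ _)]
  simp only [neg_zero, Real.exp_zero]
  ring_nf

lemma expHLU_neg_arg (t : ℝ) (ht : t < 0) : expHLU t = 0 := by
  rw [expHLU_eq_integral, integral_expMeas]
  apply setIntegral_eq_zero_of_forall_eq_zero
  intro x hx
  have hx' : (0:ℝ) < x := hx
  have : ¬ (0 ≤ 2 * t - x) := by linarith
  simp [hlG, this]

lemma hasDeriv_cdf (t : ℝ) : HasDerivAt (fun t => 1 - Real.exp (-2 * t) * (1 + 2 * t))
    (4 * t * Real.exp (-2 * t)) t := by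
  have h1 : HasDerivAt (fun t : ℝ => -2 * t) (-2) t := by
    simpa using (hasDerivAt_id t).const_mul (-2)
  have h2 : HasDerivAt (fun t : ℝ => 1 + 2 * t) 2 t := by
    simpa using ((hasDerivAt_id t).const_mul 2).const_add 1
  refine ((h1.exp.mul h2).const_sub 1).congr_deriv ?_
  ring

lemma density_eq :
    Measure.map (fun q : ℝ × ℝ => (q.1 + q.2) / 2) (expMeas.prod expMeas) =
      volume.withDensity fun t =>
        ENNReal.ofReal (if 0 ≤ t then 4 * t * Real.exp (-2 * t) else 0) := by
  have hmeas : Measurable (fun q : ℝ × ℝ => (q.1 + q.2) / 2) := by fun_prop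
  haveI := Measure.isProbabilityMeasure_map (μ := expMeas.prod expMeas) hmeas.aemeasurable
  apply Measure.ext_of_Iic
  intro t
  have hl : Measure.map (fun q : ℝ × ℝ => (q.1 + q.2) / 2) (expMeas.prod expMeas) (Iic t)
      = ENNReal.ofReal (expHLU t) := by
    rw [Measure.map_apply hmeas measurableSet_Iic, expHLU, ENNReal.ofReal_toReal (measure_ne_top _ _)]
    rfl
  rw [hl, withDensity_apply _ measurableSet_Iic]
  rcases lt_or_ge t 0 with ht | ht
  · rw [expHLU_neg_arg t ht, ENNReal.ofReal_zero, eq_comm]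
    rw [setLIntegral_congr_fun (g := fun _ => 0) measurableSet_Iic]
    · simp
    · intro x hx
      have hx' : x ≤ t := hx
      have : ¬ (0 ≤ x) := by linarith
      simp [this]
  · have h2 : ∫⁻ x in Iic t, ENNReal.ofReal (if 0 ≤ x then 4 * x * Real.exp (-2 * x) else 0)
        = ∫⁻ x in Ioc 0 t, ENNReal.ofReal (4 * x * Real.exp (-2 * x)) := by
      rw [← lintegral_indicator measurableSet_Iic, ← lintegral_indicator measurableSet_Ioc]
      congr 1
      ext x
      rcases lt_trichotomy x 0 with hx | hx | hx
      · simp [hx.le, not_le.2 hx, not_lt.2 hx.le, indicator]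
      · simp [hx, indicator]
      · simp [hx.le, hx, indicator]
    rw [h2, ← ofReal_integral_eq_lintegral_ofReal]
    · congr 1
      rw [← intervalIntegral.integral_of_le ht,
        intervalIntegral.integral_eq_sub_of_hasDerivAt (fun x _ => hasDeriv_cdf x)
        (Continuous.intervalIntegrable (by fun_prop) _ _), expHLU_nonneg_arg t ht]
      simp
    · exact (Continuous.integrableOn_Icc (by fun_prop)).mono_set Ioc_subset_Icc_self
    · filter_upwards [ae_restrict_mem measurableSet_Ioc] with x hx
      have := hx.1.le
      positivity

lemma median_unique : ∃! h : ℝ, 0 < h ∧ expHLU h = 1 / 2 := by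
  have hc : Continuous (fun t : ℝ => 1 - Real.exp (-2 * t) * (1 + 2 * t)) := by fun_prop
  have hs : StrictMonoOn (fun t : ℝ => 1 - Real.exp (-2 * t) * (1 + 2 * t)) (Ici 0) := by
    apply strictMonoOn_of_deriv_pos (convex_Ici 0) hc.continuousOn
    intro x hx
    rw [interior_Ici] at hx
    have hx' : (0:ℝ) < x := hx
    rw [(hasDeriv_cdf x).deriv]
    positivity
  have h4 : Real.exp (-2 * 2) * (1 + 2 * 2) ≤ 1 / 2 := by
    have h1 : (10:ℝ) ≤ Real.exp 4 := by
      have := Real.add_one_le_exp (1:ℝ)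
      have h2 : Real.exp 4 = Real.exp 1 ^ 4 := by rw [← Real.exp_nat_mul]; norm_num
      rw [h2]
      calc (10:ℝ) ≤ 2 ^ 4 := by norm_num
        _ ≤ _ := by gcongr; linarith
    have h3 : Real.exp (-2 * 2) = (Real.exp 4)⁻¹ := by rw [← Real.exp_neg]; norm_num
    have : (Real.exp 4)⁻¹ ≤ 10⁻¹ := by gcongr
    rw [h3]; linarith
  obtain ⟨h, hh, he⟩ := intermediate_value_Icc (by norm_num : (0:ℝ) ≤ 2) hc.continuousOn
    (show (1/2 : ℝ) ∈ _ by constructor <;> norm_num at h4 ⊢ <;> linarith)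
  have hpos : 0 < h := by
    rcases hh.1.lt_or_eq with h0 | h0
    · exact h0
    · subst h0; norm_num at he
  refine ⟨h, ⟨hpos, by rw [expHLU_nonneg_arg h hpos.le]; exact he⟩, ?_⟩
  rintro y ⟨hy, hy2⟩
  rw [expHLU_nonneg_arg y hy.le] at hy2
  exact hs.injOn hy.le hpos.le (hy2.trans he.symm)

lemma psi_sq_integral (h : ℝ) (hh : 0 < h) :
    ∫ x, ((expMeas {y | (x + y) / 2 ≤ h}).toReal - 1 / 2) ^ 2 ∂expMeas
      = 1 / 4 - 2 * h * Real.exp (-2 * h) + Real.exp (-2 * h) - Real.exp (-2 * h) ^ 2 := by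
  simp_rw [expMeas_slice]
  rw [integral_expMeas, ← Ioc_union_Ioi_eq_Ioi (show (0:ℝ) ≤ 2 * h by linarith)]
  have e1 : EqOn (fun x => Real.exp (-x) * (hlG (2 * h - x) - 1 / 2) ^ 2)
      (fun x => Real.exp (-x) / 4 - Real.exp (-2 * h) + Real.exp (-2 * h) ^ 2 * Real.exp x)
      (Ioc 0 (2 * h)) := by
    intro x hx
    have h1 : Real.exp (-(2 * h - x)) = Real.exp (-2 * h) * Real.exp x := by
      rw [← Real.exp_add]; ring_nf
    have h2 : Real.exp (-x) * Real.exp x = 1 := by rw [← Real.exp_add]; simp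
    simp only [hlG, sub_nonneg, hx.2, if_true]
    rw [h1]
    linear_combination (Real.exp (-2 * h) ^ 2 * Real.exp x - Real.exp (-2 * h)) * h2
  have e2 : EqOn (fun x => Real.exp (-x) * (hlG (2 * h - x) - 1 / 2) ^ 2)
      (fun x => Real.exp (-x) * (1 / 4)) (Ioi (2 * h)) := by
    intro x hx
    have hx' : 2 * h < x := hx
    have : ¬ (0 ≤ 2 * h - x) := by linarith
    simp only [hlG, this, if_false]
    ring
  have i2 : IntegrableOn (fun x => Real.exp (-x) * (1 / 4)) (Ioi (2 * h)) :=
    (integrableOn_exp_neg_Ioi (2 * h)).mul_const _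
  rw [setIntegral_union (Ioc_disjoint_Ioi le_rfl) measurableSet_Ioi
    (IntegrableOn.congr_fun ((Continuous.integrableOn_Icc (by fun_prop)).mono_set
      Ioc_subset_Icc_self) e1.symm measurableSet_Ioc)
    (i2.congr_fun e2.symm measurableSet_Ioi),
    setIntegral_congr_fun measurableSet_Ioc e1, setIntegral_congr_fun measurableSet_Ioi e2,
    integral_mul_const, integral_exp_neg_Ioi, ← intervalIntegral.integral_of_le (by linarith),
    intervalIntegral.integral_eq_sub_of_hasDerivAt
      (f := fun x => -Real.exp (-x) / 4 - x * Real.exp (-2 * h)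
        + Real.exp (-2 * h) ^ 2 * Real.exp x)
      (fun x _ => by
        have := ((((hasDerivAt_neg x).exp.neg).div_const 4).sub
          ((hasDerivAt_id x).mul_const (Real.exp (-2 * h)))).add
          ((Real.hasDerivAt_exp x).const_mul (Real.exp (-2 * h) ^ 2))
        refine this.congr_deriv ?_
        ring)
      (Continuous.intervalIntegrable (by fun_prop) _ _)]
  have h3 : Real.exp (-2 * h) * Real.exp (2 * h) = 1 := by rw [← Real.exp_add]; simp
  have h4 : Real.exp (-(2 * h)) = Real.exp (-2 * h) := by ring_nf
  simp only [neg_zero, Real.exp_zero, h4]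
  linear_combination Real.exp (-2 * h) * h3

/-- For `X, Y` i.i.d. Exp(1): `(X+Y)/2` has distribution function
`U(t) = 1 - e^{-2t}(1 + 2t)` on `[0, ∞)` and density `u(t) = 4 t e^{-2t}`; the median `h`
of `(X+Y)/2` is the unique `h > 0` with `U(h) = 1/2` and satisfies `e^{2h} = 2(1 + 2h)`;
and the i.i.d. Hodges–Lehmann long-run variance equals
`σ²_HL = 4 E[ψ(X)²]/u(h)² = (3 - (2h - 1)²)/(2h)²` with `ψ(x) = P((x+Y)/2 ≤ h) - 1/2`. -/
theorem hl_lrv_exponential :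
    (∀ t : ℝ, 0 ≤ t → expHLU t = 1 - Real.exp (-2 * t) * (1 + 2 * t)) ∧
    (Measure.map (fun q : ℝ × ℝ => (q.1 + q.2) / 2) (expMeas.prod expMeas) =
      volume.withDensity fun t =>
        ENNReal.ofReal (if 0 ≤ t then 4 * t * Real.exp (-2 * t) else 0)) ∧
    (∃! h : ℝ, 0 < h ∧ expHLU h = 1 / 2) ∧
    ∀ h : ℝ, 0 < h → expHLU h = 1 / 2 →
      Real.exp (2 * h) = 2 * (1 + 2 * h) ∧
      4 * (∫ x, ((expMeas {y | (x + y) / 2 ≤ h}).toReal - 1 / 2) ^ 2 ∂expMeas)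
          / (4 * h * Real.exp (-2 * h)) ^ 2 = (3 - (2 * h - 1) ^ 2) / (2 * h) ^ 2 := by
  refine ⟨expHLU_nonneg_arg, density_eq, median_unique, ?_⟩
  intro h hh hU
  rw [expHLU_nonneg_arg h hh.le] at hU
  have h3 : Real.exp (-2 * h) * Real.exp (2 * h) = 1 := by rw [← Real.exp_add]; simp
  have hE : Real.exp (2 * h) = 2 * (1 + 2 * h) := by
    linear_combination (2 * Real.exp (2 * h)) * hU + 2 * (1 + 2 * h) * h3
  refine ⟨hE, ?_⟩
  rw [psi_sq_integral h hh]
  have hd : (1 + 2 * h) ≠ 0 := by positivity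
  have hv : Real.exp (-2 * h) = 1 / (2 * (1 + 2 * h)) := by
    rw [← hE, eq_div_iff (Real.exp_pos _).ne', h3]
  rw [hv]
  field_simp
  ring
end
end
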